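/- arXiv:1504.06238 — 4 statements merged into one kernel-verified Lean document; each statement's English description precedes it below -/
import Mathlib

section
/- Fix an integer k ≥ 2 and δ ∈ (0, 1/2). Let |𝒞_n| be the number of vertices of the one-in-core of the random k-out digraph 𝒟_{n,k}. Then limsup_{n→∞} n · P( | |𝒞_n| − ν_k n | > n^{1/2+δ} ) ≤ 1. In particular |𝒞_n|/n converges in probability to ν_k. -/
open scoped Classical
open Filter MeasureTheory

/-- Probability of an event under the uniform random `k`-out digraph model `𝒟_{n,k}`:
a uniformly random function `f : [n] × [k] → [n]`. -/
noncomputable def prob (n k : ℕ) (P : (Fin n × Fin k → Fin n) → Prop) : ℝ :=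
  ((Finset.univ.filter P).card : ℝ) / (Fintype.card (Fin n × Fin k → Fin n) : ℝ)

/-- One arc step: there is a labeled arc from `u` to `v`. -/
def Step {n k : ℕ} (f : Fin n × Fin k → Fin n) (u v : Fin n) : Prop :=
  ∃ i : Fin k, f (u, i) = v

/-- `u` reaches `v` by following finitely many arcs. -/
def Reaches {n k : ℕ} (f : Fin n × Fin k → Fin n) : Fin n → Fin n → Prop :=
  Relation.ReflTransGen (Step f)

/-- A set of vertices is closed if no arc leaves it. -/
def IsClosedSet {n k : ℕ} (f : Fin n × Fin k → Fin n) (S : Set (Fin n)) : Prop :=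
  ∀ v ∈ S, ∀ i : Fin k, f (v, i) ∈ S

/-- A set of vertices is strongly connected if it is nonempty and
any two of its vertices reach each other. -/
def IsStrConn {n k : ℕ} (f : Fin n × Fin k → Fin n) (S : Set (Fin n)) : Prop :=
  S.Nonempty ∧ ∀ u ∈ S, ∀ v ∈ S, Reaches f u v

/-- `G` is the giant: a closed strongly connected set of maximum size,
ties broken by choosing the one containing the smallest vertex label. -/
def IsGiant {n k : ℕ} (f : Fin n × Fin k → Fin n) (G : Set (Fin n)) : Prop :=
  IsClosedSet f G ∧ IsStrConn f G ∧
    (∀ S : Set (Fin n), IsClosedSet f S → IsStrConn f S → S.ncard ≤ G.ncard) ∧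
    (∀ S : Set (Fin n), IsClosedSet f S → IsStrConn f S → S.ncard = G.ncard →
      ∃ v ∈ G, ∀ u ∈ S, v ≤ u)

/-- The one-in-core: the largest (equivalently, the union of all) sets `S`
in which every vertex has an in-neighbor inside `S`. -/
def oneCore {n k : ℕ} (f : Fin n × Fin k → Fin n) : Set (Fin n) :=
  ⋃₀ {S : Set (Fin n) | ∀ v ∈ S, ∃ u ∈ S, ∃ i : Fin k, f (u, i) = v}

/-! ### The one-in-core -/

lemma exists_inNeighbor_of_mem_oneCore {n k : ℕ} {f : Fin n × Fin k → Fin n} {v : Fin n}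
    (hv : v ∈ oneCore f) : ∃ u ∈ oneCore f, ∃ i : Fin k, f (u, i) = v := by
  obtain ⟨S, hS, hvS⟩ := hv
  obtain ⟨u, hu, i, hi⟩ := hS v hvS
  exact ⟨u, ⟨S, hS, hu⟩, i, hi⟩

lemma isClosedSet_oneCore {n k : ℕ} (f : Fin n × Fin k → Fin n) :
    IsClosedSet f (oneCore f) := by
  intro v hv i
  refine ⟨insert (f (v, i)) (oneCore f), ?_, Set.mem_insert _ _⟩
  rintro w (rfl | hw)
  · exact ⟨v, Set.mem_insert_of_mem _ hv, i, rfl⟩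
  · obtain ⟨u, hu, j, hj⟩ := exists_inNeighbor_of_mem_oneCore hw
    exact ⟨u, Set.mem_insert_of_mem _ hu, j, hj⟩

lemma oneCore_nonempty {n k : ℕ} (hn : 0 < n) (hk : 0 < k) (f : Fin n × Fin k → Fin n) :
    (oneCore f).Nonempty := by
  set g : Fin n → Fin n := fun v => f (v, ⟨0, hk⟩) with hg
  obtain ⟨a, b, hne, hab⟩ := Finite.exists_ne_map_eq_of_infinite
    (fun j : ℕ => g^[j] ⟨0, hn⟩)
  wlog hlt : a < b generalizing a b
  · exact this b a hne.symm hab.symm (by omega)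
  refine ⟨g^[a] ⟨0, hn⟩, {w | ∃ j, a ≤ j ∧ g^[j] ⟨0, hn⟩ = w}, ?_, a, le_rfl, rfl⟩
  rintro w ⟨j, hj, rfl⟩
  rcases hj.eq_or_lt with rfl | hj
  · refine ⟨g^[b - 1] ⟨0, hn⟩, ⟨b - 1, by omega, rfl⟩, ⟨0, hk⟩, ?_⟩
    change g (g^[b - 1] ⟨0, hn⟩) = _
    rw [← Function.iterate_succ_apply' g, Nat.succ_eq_add_one, Nat.sub_add_cancel (by omega)]
    exact hab.symm
  · refine ⟨g^[j - 1] ⟨0, hn⟩, ⟨j - 1, by omega, rfl⟩, ⟨0, hk⟩, ?_⟩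
    change g (g^[j - 1] ⟨0, hn⟩) = _
    rw [← Function.iterate_succ_apply' g, Nat.succ_eq_add_one, Nat.sub_add_cancel (by omega)]

/-! ### Reduction to an occupancy problem -/

/-- The number of ways to throw `N` labeled balls into `n` labeled bins so that exactly `m`
bins are occupied. -/
noncomputable def occupancyCount (n N m : ℕ) : ℕ :=
  (Finset.univ.filter fun x : Fin N → Fin n => (Finset.univ.image x).card = m).card

lemma occupancyCount_eq_sum (n N m : ℕ) :
    occupancyCount n N m = ∑ S ∈ Finset.powersetCard m (Finset.univ : Finset (Fin n)),
      (Finset.univ.filter fun x : Fin N → Fin n => Finset.univ.image x = S).card := by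
  unfold occupancyCount
  rw [Finset.card_eq_sum_card_fiberwise (f := fun x : Fin N → Fin n => Finset.univ.image x)
    (t := Finset.powersetCard m (Finset.univ : Finset (Fin n)))]
  · refine Finset.sum_congr rfl fun S hS => ?_
    rw [Finset.filter_filter]
    congr 1
    ext x
    simp only [Finset.mem_filter, Finset.mem_univ, true_and, and_iff_right_iff_imp]
    rintro rfl
    exact (Finset.mem_powersetCard.1 hS).2
  · intro x hx
    simpa [Finset.mem_powersetCard] using hx

lemma occupancyCount_le (n N m : ℕ) : occupancyCount n N m ≤ n.choose m * m ^ N := by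
  rw [occupancyCount_eq_sum]
  refine (Finset.sum_le_card_nsmul _ _ (m ^ N) fun S hS => ?_).trans ?_
  · have hsub : (Finset.univ.filter fun x : Fin N → Fin n => Finset.univ.image x = S) ⊆
        Fintype.piFinset fun _ => S := by
      intro x hx
      simp only [Finset.mem_filter, Finset.mem_univ, true_and] at hx
      simp only [Fintype.mem_piFinset]
      intro i
      rw [← hx]
      exact Finset.mem_image_of_mem _ (Finset.mem_univ i)
    refine (Finset.card_le_card hsub).trans ?_
    simp [Fintype.card_piFinset, (Finset.mem_powersetCard.1 hS).2]
  · simp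

lemma card_image_slice_eq_le {n k m : ℕ} {S : Finset (Fin n)} (hS : S.card = m) :
    (Finset.univ.filter fun f : Fin n × Fin k → Fin n =>
      (S ×ˢ (Finset.univ : Finset (Fin k))).image f = S).card ≤
    (Finset.univ.filter fun x : Fin (k * m) → Fin n => Finset.univ.image x = S).card *
      n ^ (k * (n - m)) := by
  have hcard : Fintype.card {p : Fin n × Fin k // p.1 ∈ S} = k * m := by
    rw [Fintype.card_subtype]
    have : (Finset.univ.filter fun p : Fin n × Fin k => p.1 ∈ S) = S ×ˢ Finset.univ := by
      ext p; simp
    rw [this, Finset.card_product, hS, Finset.card_univ, Fintype.card_fin, mul_comm]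
  have hcard' : Fintype.card {p : Fin n × Fin k // p.1 ∉ S} = k * (n - m) := by
    rw [Fintype.card_subtype]
    have : (Finset.univ.filter fun p : Fin n × Fin k => p.1 ∉ S) = Sᶜ ×ˢ Finset.univ := by
      ext p; simp
    rw [this, Finset.card_product, Finset.card_compl, hS, Finset.card_univ, Fintype.card_fin,
      Fintype.card_fin, mul_comm]
  let e : Fin (k * m) ≃ {p : Fin n × Fin k // p.1 ∈ S} := (Fintype.equivFinOfCardEq hcard).symm
  have hpow : Fintype.card ({p : Fin n × Fin k // p.1 ∉ S} → Fin n) = n ^ (k * (n - m)) := by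
    rw [Fintype.card_fun, hcard', Fintype.card_fin]
  rw [← hpow, ← Finset.card_univ, ← Finset.card_product]
  refine Finset.card_le_card_of_injOn
    (fun f => (fun i => f (e i).1, fun p => f p.1)) ?_ ?_
  · intro f hf
    simp only [Finset.coe_filter, Finset.mem_univ, true_and, Set.mem_ofPred_eq] at hf
    simp only [Finset.coe_product, Set.mem_prod, Finset.coe_filter, Finset.mem_univ, true_and,
      Set.mem_ofPred_eq, Finset.coe_univ, Set.mem_univ, and_true]
    conv_rhs => rw [← hf]
    ext w
    simp only [Finset.mem_image, Finset.mem_univ, true_and, Finset.mem_product, and_true]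
    constructor
    · rintro ⟨i, rfl⟩
      exact ⟨_, (e i).2, rfl⟩
    · rintro ⟨p, hp, rfl⟩
      exact ⟨e.symm ⟨p, hp⟩, by simp⟩
  · intro f _ g _ hfg
    simp only [Prod.mk.injEq] at hfg
    ext1 p
    by_cases hp : p.1 ∈ S
    · simpa using congrFun hfg.1 (e.symm ⟨p, hp⟩)
    · exact congrFun hfg.2 ⟨p, hp⟩

lemma card_ncard_oneCore_eq_le (n k m : ℕ) :
    (Finset.univ.filter fun f : Fin n × Fin k → Fin n => (oneCore f).ncard = m).card ≤
      occupancyCount n (k * m) m * n ^ (k * (n - m)) := by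
  rw [occupancyCount_eq_sum, Finset.sum_mul]
  refine le_trans ?_ (Finset.sum_le_sum fun S hS =>
    card_image_slice_eq_le (k := k) (Finset.mem_powersetCard.1 hS).2)
  refine le_trans (Finset.card_le_card ?_) Finset.card_biUnion_le
  intro f hf
  simp only [Finset.mem_filter, Finset.mem_univ, true_and] at hf
  simp only [Finset.mem_biUnion, Finset.mem_filter, Finset.mem_univ, true_and]
  refine ⟨(oneCore f).toFinset, ?_, ?_⟩
  · rw [Finset.mem_powersetCard, ← Set.ncard_eq_toFinset_card']
    exact ⟨Finset.subset_univ _, hf⟩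
  · ext w
    simp only [Finset.mem_image, Finset.mem_product, Set.mem_toFinset, Finset.mem_univ, and_true]
    constructor
    · rintro ⟨⟨v, i⟩, hv, rfl⟩
      exact isClosedSet_oneCore f v hv i
    · intro hw
      obtain ⟨u, hu, i, hi⟩ := exists_inNeighbor_of_mem_oneCore hw
      exact ⟨(u, i), hu, hi⟩

lemma prob_ncard_oneCore_eq_le {n k m : ℕ} (hn : 0 < n) (hm : m ≤ n) :
    prob n k (fun f => (oneCore f).ncard = m) ≤
      (occupancyCount n (k * m) m : ℝ) / (n : ℝ) ^ (k * m) := by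
  have hn' : (0 : ℝ) < n := by exact_mod_cast hn
  unfold prob
  rw [Fintype.card_fun, Fintype.card_prod, Fintype.card_fin, Fintype.card_fin]
  have hsplit : n * k = k * m + k * (n - m) := by
    rw [← mul_add, Nat.add_sub_cancel' hm, mul_comm]
  rw [hsplit, Nat.cast_pow, pow_add, div_le_div_iff₀ (by positivity) (by positivity)]
  have h : ((Finset.univ.filter fun f : Fin n × Fin k → Fin n =>
      (oneCore f).ncard = m).card : ℝ) ≤
      occupancyCount n (k * m) m * (n : ℝ) ^ (k * (n - m)) := by
    exact_mod_cast card_ncard_oneCore_eq_le n k m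
  calc _ ≤ occupancyCount n (k * m) m * (n : ℝ) ^ (k * (n - m)) * (n : ℝ) ^ (k * m) := by
        refine mul_le_mul_of_nonneg_right ?_ (by positivity)
        refine le_of_eq_of_le ?_ h
        congr!
    _ = _ := by ring

/-! ### Exponential moments of the number of empty bins -/

lemma sum_exp_card_compl_insert {n : ℕ} (A : Finset (Fin n)) (μ : ℝ) :
    ∑ a : Fin n, Real.exp (μ * ((insert a A)ᶜ.card : ℝ)) =
      Real.exp (μ * (Aᶜ.card : ℝ)) * (n - Aᶜ.card * (1 - Real.exp (-μ))) := by
  have hA : ∀ a ∈ A, Real.exp (μ * ((insert a A)ᶜ.card : ℝ)) = Real.exp (μ * (Aᶜ.card : ℝ)) := by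
    intro a ha
    rw [Finset.insert_eq_of_mem ha]
  have hAc : ∀ a ∈ Aᶜ, Real.exp (μ * ((insert a A)ᶜ.card : ℝ)) =
      Real.exp (μ * (Aᶜ.card : ℝ)) * Real.exp (-μ) := by
    intro a ha
    rw [Finset.compl_insert, Finset.card_erase_of_mem ha, ← Real.exp_add,
      Nat.cast_pred (Finset.card_pos.2 ⟨a, ha⟩)]
    congr 1
    ring
  rw [← Finset.sum_add_sum_compl A, Finset.sum_congr rfl hA, Finset.sum_congr rfl hAc]
  have hcard : (A.card : ℝ) = n - Aᶜ.card := by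
    have := Finset.card_add_card_compl A
    rw [Fintype.card_fin] at this
    rw [eq_sub_iff_add_eq]
    exact_mod_cast this
  simp only [Finset.sum_const, nsmul_eq_mul, hcard]
  ring

lemma exp_mul_sub_le {n z μ : ℝ} (hn : 1 ≤ n) (hz : 0 ≤ z) (hzn : z ≤ n) (hμ : |μ| ≤ 1) :
    Real.exp (μ * z) * (n - z * (1 - Real.exp (-μ))) ≤
      n * Real.exp (μ ^ 2 + |μ| / n) * Real.exp (μ * Real.exp (-(1 / n)) * z) := by
  have hn0 : 0 < n := by linarith
  have h1 : Real.exp (-μ) ≤ 1 - μ + μ ^ 2 := by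
    have := (abs_le.1 (Real.abs_exp_sub_one_sub_id_le (x := -μ) (by simpa using hμ))).2
    nlinarith
  have h2 : Real.exp (-(1 / n)) ≤ 1 - 1 / n + (1 / n) ^ 2 := by
    have h : |-(1 / n)| ≤ 1 := by
      rw [abs_neg, abs_of_pos (by positivity), div_le_one hn0]; exact hn
    have := (abs_le.1 (Real.abs_exp_sub_one_sub_id_le h)).2
    nlinarith
  have h3 : 1 - 1 / n ≤ Real.exp (-(1 / n)) := by
    have := Real.add_one_le_exp (-(1 / n)); linarith
  have h4 : μ * (1 - 1 / n - Real.exp (-(1 / n))) ≤ |μ| * (1 / n) ^ 2 := by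
    refine (le_abs_self _).trans ?_
    rw [abs_mul]
    gcongr
    rw [abs_le]
    constructor <;> [linarith; nlinarith [sq_nonneg (1 / n)]]
  have h5 : n - z * (1 - Real.exp (-μ)) ≤ n * Real.exp (-(z / n * (1 - Real.exp (-μ)))) := by
    have := Real.add_one_le_exp (-(z / n * (1 - Real.exp (-μ))))
    calc n - z * (1 - Real.exp (-μ)) = n * (-(z / n * (1 - Real.exp (-μ))) + 1) := by
          field_simp; ring
      _ ≤ _ := by gcongr
  refine (mul_le_mul_of_nonneg_left h5 (Real.exp_pos _).le).trans ?_
  rw [mul_left_comm, ← Real.exp_add, mul_assoc, ← Real.exp_add]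
  refine mul_le_mul_of_nonneg_left (Real.exp_le_exp.2 ?_) hn0.le
  have h6 : μ - μ * Real.exp (-(1 / n)) - (1 - Real.exp (-μ)) / n ≤
      |μ| * (1 / n) ^ 2 + μ ^ 2 / n := by
    have : (μ - μ ^ 2) / n ≤ (1 - Real.exp (-μ)) / n :=
      div_le_div_of_nonneg_right (by linarith) hn0.le
    have e : (μ - μ ^ 2) / n = μ * (1 / n) - μ ^ 2 / n := by ring
    rw [e] at this
    linarith
  have h7 : z * (μ - μ * Real.exp (-(1 / n)) - (1 - Real.exp (-μ)) / n) ≤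
      μ ^ 2 + |μ| / n := by
    calc _ ≤ z * (|μ| * (1 / n) ^ 2 + μ ^ 2 / n) := by gcongr
      _ ≤ n * (|μ| * (1 / n) ^ 2 + μ ^ 2 / n) := by gcongr
      _ = _ := by field_simp; ring
  have e : z / n * (1 - Real.exp (-μ)) = z * ((1 - Real.exp (-μ)) / n) := by ring
  rw [e]
  linarith

lemma sum_exp_card_empty_le {n : ℕ} (hn : 0 < n) (N : ℕ) {μ : ℝ} (hμ : |μ| ≤ 1) :
    ∑ x : Fin N → Fin n, Real.exp (μ * ((Finset.univ.image x)ᶜ.card : ℝ)) ≤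
      (n : ℝ) ^ N * Real.exp (N * (μ ^ 2 + |μ| / n) + μ * n * Real.exp (-(N / n))) := by
  have hn1 : (1 : ℝ) ≤ n := by exact_mod_cast hn
  induction N generalizing μ with
  | zero => simp
  | succ N ih =>
    set q := Real.exp (-(1 / (n : ℝ))) with hq
    have hq0 : 0 < q := Real.exp_pos _
    have hq1 : q ≤ 1 := Real.exp_le_one_iff.2 (by simp)
    have habs : |μ * q| ≤ |μ| := by
      rw [abs_mul, abs_of_pos hq0]
      exact mul_le_of_le_one_right (abs_nonneg _) hq1
    have himage : ∀ (a : Fin n) (y : Fin N → Fin n),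
        Finset.univ.image (Fin.cons a y : Fin (N + 1) → Fin n) =
          insert a (Finset.univ.image y) := by
      intro a y
      ext w
      simp [Fin.exists_fin_succ, eq_comm]
    have hsum : ∑ x : Fin (N + 1) → Fin n, Real.exp (μ * ((Finset.univ.image x)ᶜ.card : ℝ)) =
        ∑ y : Fin N → Fin n, ∑ a : Fin n,
          Real.exp (μ * ((insert a (Finset.univ.image y))ᶜ.card : ℝ)) := by
      rw [← (Fin.consEquiv fun _ : Fin (N + 1) => Fin n).sum_comp, Fintype.sum_prod_type,
        Finset.sum_comm]
      refine Finset.sum_congr rfl fun y _ => Finset.sum_congr rfl fun a _ => ?_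
      rw [← himage]
      rfl
    rw [hsum]
    calc _ ≤ ∑ y : Fin N → Fin n, n * Real.exp (μ ^ 2 + |μ| / n) *
          Real.exp (μ * q * ((Finset.univ.image y)ᶜ.card : ℝ)) := by
          refine Finset.sum_le_sum fun y _ => ?_
          rw [sum_exp_card_compl_insert]
          refine exp_mul_sub_le hn1 (by positivity) ?_ hμ
          exact_mod_cast (Finset.card_le_univ _).trans_eq (Fintype.card_fin n)
      _ ≤ n * Real.exp (μ ^ 2 + |μ| / n) * ((n : ℝ) ^ N * Real.exp
            (N * ((μ * q) ^ 2 + |μ * q| / n) + μ * q * n * Real.exp (-(N / n)))) := by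
          rw [← Finset.mul_sum]
          gcongr
          exact ih (habs.trans hμ)
      _ ≤ n * Real.exp (μ ^ 2 + |μ| / n) * ((n : ℝ) ^ N * Real.exp
            (N * (μ ^ 2 + |μ| / n) + μ * q * n * Real.exp (-(N / n)))) := by
          have hsq : (μ * q) ^ 2 ≤ μ ^ 2 := sq_le_sq.2 habs
          gcongr
      _ = _ := by
          have he : Real.exp (-(((N + 1 : ℕ) : ℝ) / n)) = q * Real.exp (-(N / n)) := by
            rw [hq, ← Real.exp_add]; congr 1; push_cast; ring
          rw [he, mul_mul_mul_comm, ← Real.exp_add, pow_succ']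
          push_cast
          ring_nf

lemma occupancyCount_div_le {n : ℕ} (hn : 0 < n) {N m : ℕ} (hm : m ≤ n) {μ : ℝ} (hμ : |μ| ≤ 1) :
    (occupancyCount n N m : ℝ) / (n : ℝ) ^ N ≤
      Real.exp (N * (μ ^ 2 + |μ| / n) - μ * (n - m - n * Real.exp (-(N / n)))) := by
  have hn' : (0 : ℝ) < n := by exact_mod_cast hn
  rw [div_le_iff₀ (by positivity)]
  have h : occupancyCount n N m * Real.exp (μ * (n - m)) ≤
      ∑ x : Fin N → Fin n, Real.exp (μ * ((Finset.univ.image x)ᶜ.card : ℝ)) := by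
    unfold occupancyCount
    rw [← nsmul_eq_mul]
    refine le_trans (Finset.card_nsmul_le_sum _ _ _ fun x hx => ?_)
      (Finset.sum_le_sum_of_subset_of_nonneg (Finset.filter_subset _ _)
        fun _ _ _ => (Real.exp_pos _).le)
    simp only [Finset.mem_filter, Finset.mem_univ, true_and] at hx
    rw [Finset.card_compl, hx, Fintype.card_fin, Nat.cast_sub hm]
  have h' := h.trans (sum_exp_card_empty_le hn N hμ)
  rw [← le_div_iff₀ (Real.exp_pos _)] at h'
  refine h'.trans_eq ?_
  rw [mul_div_assoc, ← Real.exp_sub, mul_comm]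
  congr 2
  ring

/-! ### Small cores -/

lemma succ_pow_le (m : ℕ) : ((m + 1 : ℕ) : ℝ) ^ m ≤ 3 * (m : ℝ) ^ m := by
  rcases m.eq_zero_or_pos with rfl | hm
  · norm_num
  have hm' : (0 : ℝ) < m := by exact_mod_cast hm
  have h : (1 + 1 / (m : ℝ)) ^ m ≤ 3 := by
    calc (1 + 1 / (m : ℝ)) ^ m ≤ Real.exp (1 / m) ^ m := by
          gcongr
          rw [add_comm]
          exact Real.add_one_le_exp _
      _ = Real.exp 1 := by
          rw [← Real.exp_nat_mul]; congr 1; field_simp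
      _ ≤ 3 := Real.exp_one_lt_three.le
  calc ((m + 1 : ℕ) : ℝ) ^ m = (1 + 1 / (m : ℝ)) ^ m * (m : ℝ) ^ m := by
        rw [← mul_pow]; congr 1; push_cast; field_simp
    _ ≤ _ := by gcongr

lemma pow_div_factorial_mul_pow_le {n m : ℕ} (hm : 2 ≤ m) (hmn : (m : ℝ) ≤ 1 / 18 * n) :
    (m : ℝ) ^ (2 * m) / (m.factorial * (n : ℝ) ^ m) ≤ 32 / (n : ℝ) ^ 2 * (1 / 2) ^ m := by
  induction m, hm using Nat.le_induction with
  | base =>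
    rw [Nat.factorial_two]
    apply le_of_eq
    push_cast
    ring
  | succ m hm ih =>
    have hn : (0 : ℝ) < n := by
      push_cast at hmn
      have : (0 : ℝ) ≤ m := Nat.cast_nonneg m
      linarith
    have ih' := ih (by push_cast at hmn; linarith)
    have hstep : ((m + 1 : ℕ) : ℝ) ^ (2 * (m + 1)) ≤
        9 * (m : ℝ) ^ (2 * m) * ((m + 1 : ℕ) : ℝ) ^ 2 := by
      rw [mul_add, pow_add, mul_one]
      gcongr
      calc ((m + 1 : ℕ) : ℝ) ^ (2 * m) = (((m + 1 : ℕ) : ℝ) ^ m) ^ 2 := by ring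
        _ ≤ (3 * (m : ℝ) ^ m) ^ 2 := by gcongr; exact succ_pow_le m
        _ = _ := by ring
    calc ((m + 1 : ℕ) : ℝ) ^ (2 * (m + 1)) / ((m + 1).factorial * (n : ℝ) ^ (m + 1))
        ≤ 9 * (m : ℝ) ^ (2 * m) * ((m + 1 : ℕ) : ℝ) ^ 2 /
            ((m + 1).factorial * (n : ℝ) ^ (m + 1)) := by gcongr
      _ = 9 * ((m + 1 : ℕ) : ℝ) / n * ((m : ℝ) ^ (2 * m) / (m.factorial * (n : ℝ) ^ m)) := by
          rw [Nat.factorial_succ]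
          push_cast
          field_simp
          ring
      _ ≤ 1 / 2 * (32 / (n : ℝ) ^ 2 * (1 / 2) ^ m) := by
          refine mul_le_mul ?_ ih' (by positivity) (by norm_num)
          rw [div_le_iff₀ hn]
          linarith
      _ = _ := by ring

lemma occupancyCount_div_le_pow_div {n k m : ℕ} (hn : 0 < n) (hk : 2 ≤ k) (hm : m ≤ n) :
    (occupancyCount n (k * m) m : ℝ) / (n : ℝ) ^ (k * m) ≤
      (m : ℝ) ^ (2 * m) / (m.factorial * (n : ℝ) ^ m) := by
  have hn' : (0 : ℝ) < n := by exact_mod_cast hn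
  have hmn : (m : ℝ) / n ≤ 1 := by
    rw [div_le_one hn']
    exact_mod_cast hm
  have h : (occupancyCount n (k * m) m : ℝ) ≤ n.choose m * (m : ℝ) ^ (k * m) := by
    exact_mod_cast occupancyCount_le n (k * m) m
  calc (occupancyCount n (k * m) m : ℝ) / (n : ℝ) ^ (k * m)
      ≤ n.choose m * (m : ℝ) ^ (k * m) / (n : ℝ) ^ (k * m) := by gcongr
    _ = n.choose m * ((m : ℝ) / n) ^ (k * m) := by rw [mul_div_assoc, div_pow]
    _ ≤ (n : ℝ) ^ m / m.factorial * ((m : ℝ) / n) ^ (2 * m) := by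
        gcongr ?_ * ?_
        · exact Nat.choose_le_pow_div m n
        · exact pow_le_pow_of_le_one (by positivity) hmn (Nat.mul_le_mul_right m hk)
    _ = _ := by
        rw [div_pow, two_mul, pow_add (n : ℝ)]
        field_simp

/-! ### The fluid limit -/

lemma exists_gap {κ ν : ℝ} (hκ : 0 < κ) (hν : 0 < ν) (h : 1 - ν - Real.exp (-(κ * ν)) = 0) :
    ∃ η c : ℝ, η ≤ 1 / 18 ∧ 0 < c ∧
      ∀ s, η ≤ s → c * |s - ν| ≤ |1 - s - Real.exp (-(κ * s))| := by
  set g : ℝ → ℝ := fun s => 1 - s - Real.exp (-(κ * s)) with hg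
  have hconc : ∀ x y a b : ℝ, 0 ≤ a → 0 ≤ b → a + b = 1 →
      a * g x + b * g y ≤ g (a * x + b * y) := by
    intro x y a b ha hb hab
    have := convexOn_exp.2 (Set.mem_univ (-(κ * x))) (Set.mem_univ (-(κ * y))) ha hb hab
    simp only [smul_eq_mul] at this
    have e : -(κ * (a * x + b * y)) = a * -(κ * x) + b * -(κ * y) := by ring
    simp only [hg, e]
    nlinarith
  set η := min (1 / 18) (ν / 2) with hη
  have hη0 : 0 < η := by positivity
  have hην : η < ν := (min_le_right _ _).trans_lt (by linarith)
  have hgν : g ν = 0 := h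
  have hgη : 0 < g η := by
    have hpos : 0 < 1 - η / ν := by
      rw [sub_pos, div_lt_one hν]; exact hην
    have hne : -(κ * ν) ≠ 0 := by nlinarith [mul_pos hκ hν]
    have := strictConvexOn_exp.2 (Set.mem_univ (0 : ℝ)) (Set.mem_univ (-(κ * ν))) hne.symm
      hpos (div_pos hη0 hν) (by ring)
    have e : (1 - η / ν) * 0 + η / ν * -(κ * ν) = -(κ * η) := by field_simp; ring
    simp only [smul_eq_mul, e, Real.exp_zero] at this
    have e2 : Real.exp (-(κ * ν)) = 1 - ν := by linarith
    have e3 : (1 - η / ν) * 1 + η / ν * (1 - ν) = 1 - η := by field_simp; ring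
    rw [e2, e3] at this
    simp only [hg]
    linarith
  refine ⟨η, g η / (ν - η), min_le_left _ _, div_pos hgη (by linarith), fun s hs => ?_⟩
  change _ ≤ |g s|
  rw [div_mul_eq_mul_div, div_le_iff₀ (by linarith)]
  rcases le_total s ν with hsν | hsν
  · rw [abs_of_nonpos (by linarith : s - ν ≤ 0)]
    have hd : 0 < ν - η := by linarith
    have := hconc η ν ((ν - s) / (ν - η)) ((s - η) / (ν - η))
      (div_nonneg (by linarith) hd.le) (div_nonneg (by linarith) hd.le) (by field_simp; ring)
    have e : (ν - s) / (ν - η) * η + (s - η) / (ν - η) * ν = s := by field_simp; ring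
    rw [e, hgν, mul_zero, add_zero, div_mul_eq_mul_div, div_le_iff₀ hd] at this
    have h2 : g s * (ν - η) ≤ |g s| * (ν - η) :=
      mul_le_mul_of_nonneg_right (le_abs_self _) hd.le
    linarith
  · rw [abs_of_nonneg (by linarith : 0 ≤ s - ν)]
    have hd : 0 < s - η := by linarith
    have := hconc η s ((s - ν) / (s - η)) ((ν - η) / (s - η))
      (div_nonneg (by linarith) hd.le) (div_nonneg (by linarith) hd.le) (by field_simp; ring)
    have e : (s - ν) / (s - η) * η + (ν - η) / (s - η) * s = ν := by field_simp; ring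
    rw [e, hgν, div_mul_eq_mul_div, div_mul_eq_mul_div, ← add_div, div_le_iff₀ hd,
      zero_mul] at this
    have h2 : -g s * (ν - η) ≤ |g s| * (ν - η) :=
      mul_le_mul_of_nonneg_right (neg_le_abs _) (by linarith)
    linarith

lemma occupancyCount_div_le_exp {n k m : ℕ} (hn : 0 < n) (hm : m ≤ n) :
    (occupancyCount n (k * m) m : ℝ) / (n : ℝ) ^ (k * m) ≤
      Real.exp (2 * k - √n * |1 - (m / n : ℝ) - Real.exp (-(k * (m / n)))|) := by
  have hn1 : (1 : ℝ) ≤ n := by exact_mod_cast hn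
  have hn0 : (0 : ℝ) < n := by linarith
  have hr1 : 1 ≤ √(n : ℝ) := Real.one_le_sqrt.2 hn1
  have hr0 : 0 < √(n : ℝ) := by linarith
  have hsq : √(n : ℝ) * √n = n := Real.mul_self_sqrt hn0.le
  have hmn : (m : ℝ) ≤ n := by exact_mod_cast hm
  set G := 1 - (m / n : ℝ) - Real.exp (-(k * (m / n))) with hG
  obtain ⟨σ, hσ, hσG⟩ : ∃ σ : ℝ, |σ| = 1 ∧ σ * G = |G| := by
    rcases le_total 0 G with h | h
    · exact ⟨1, by simp, by rw [abs_of_nonneg h, one_mul]⟩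
    · exact ⟨-1, by simp, by rw [abs_of_nonpos h]; ring⟩
  have habs : |σ / √n| = 1 / √n := by rw [abs_div, hσ, abs_of_pos hr0]
  have hinv : 1 / √(n : ℝ) ≤ 1 := by rw [div_le_one hr0]; exact hr1
  refine (occupancyCount_div_le hn (N := k * m) hm (μ := σ / √n) (habs.trans_le hinv)).trans ?_
  rw [Real.exp_le_exp]
  have h1 : (n : ℝ) - m - n * Real.exp (-((k * m : ℕ) / n)) = n * G := by
    rw [hG]
    push_cast
    rw [mul_div_assoc]
    field_simp
  have h2 : σ / √n * (n * G) = √n * |G| := by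
    rw [← hσG, div_mul_eq_mul_div, div_eq_iff hr0.ne']
    linear_combination (-(σ * G)) * hsq
  have h3 : (σ / √n) ^ 2 = 1 / n := by
    rw [← sq_abs, habs, div_pow, one_pow, sq, hsq]
  rw [h1, h2, habs, h3]
  refine sub_le_sub_right ?_ _
  calc ((k * m : ℕ) : ℝ) * (1 / n + 1 / √n / n) ≤ ((k * m : ℕ) : ℝ) * (1 / n + 1 / n) := by gcongr
    _ = 2 * k * (m / n) := by push_cast; ring
    _ ≤ 2 * k * 1 := by gcongr; rw [div_le_one hn0]; exact hmn
    _ = 2 * k := mul_one _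

/-! ### Deviation of the size of the one-in-core -/

lemma prob_nonneg (n k : ℕ) (P : (Fin n × Fin k → Fin n) → Prop) : 0 ≤ prob n k P := by
  unfold prob; positivity

lemma prob_mono {n k : ℕ} {P Q : (Fin n × Fin k → Fin n) → Prop} (h : ∀ f, P f → Q f) :
    prob n k P ≤ prob n k Q := by
  unfold prob
  refine div_le_div_of_nonneg_right ?_ (Nat.cast_nonneg _)
  exact_mod_cast Finset.card_le_card (Finset.monotone_filter_right _ fun f _ => h f)

lemma prob_le_sum {n k : ℕ} {ι : Type*} (s : Finset ι) {P : (Fin n × Fin k → Fin n) → Prop}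
    {Q : ι → (Fin n × Fin k → Fin n) → Prop} (h : ∀ f, P f → ∃ i ∈ s, Q i f) :
    prob n k P ≤ ∑ i ∈ s, prob n k (Q i) := by
  unfold prob
  rw [← Finset.sum_div]
  gcongr
  have hsub : Finset.univ.filter P ⊆ s.biUnion fun i => Finset.univ.filter (Q i) := by
    intro f hf
    simpa using h f (by simpa using hf)
  exact_mod_cast (Finset.card_le_card hsub).trans Finset.card_biUnion_le

lemma exists_prob_deviation_le {k : ℕ} (hk : 2 ≤ k) (δ : ℝ) {ν : ℝ} (hν : 0 < ν)
    (h : 1 - ν - Real.exp (-(k * ν)) = 0) :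
    ∃ c : ℝ, 0 < c ∧ ∀ n : ℕ, 0 < n →
      prob n k (fun f => (n : ℝ) ^ ((1 : ℝ) / 2 + δ) < |((oneCore f).ncard : ℝ) - ν * n|) ≤
        1 / n + 64 / (n : ℝ) ^ 2 + n * Real.exp (2 * k - c * (n : ℝ) ^ δ) := by
  have hk0 : (0 : ℝ) < k := by exact_mod_cast (by omega : 0 < k)
  obtain ⟨η, c, hη, hc, hgap⟩ := exists_gap hk0 hν h
  refine ⟨c, hc, fun n hn => ?_⟩
  have hn0 : (0 : ℝ) < n := by exact_mod_cast hn
  set E := Real.exp (2 * k - c * (n : ℝ) ^ δ) with hE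
  have hE0 : 0 < E := Real.exp_pos _
  set B := (Finset.Icc 1 n).filter
    fun m : ℕ => (n : ℝ) ^ ((1 : ℝ) / 2 + δ) < |(m : ℝ) - ν * n| with hB
  have hunion := prob_le_sum (n := n) (k := k) B
    (P := fun f => (n : ℝ) ^ ((1 : ℝ) / 2 + δ) < |((oneCore f).ncard : ℝ) - ν * n|)
    (Q := fun m f => (oneCore f).ncard = m) (by
      intro f hf
      refine ⟨(oneCore f).ncard, ?_, rfl⟩
      rw [hB, Finset.mem_filter, Finset.mem_Icc]
      refine ⟨⟨?_, ?_⟩, hf⟩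
      · exact (Set.ncard_pos (Set.toFinite _)).2 (oneCore_nonempty hn (by omega) f)
      · simpa using Set.ncard_le_card (oneCore f))
  have hterm : ∀ m ∈ B, prob n k (fun f => (oneCore f).ncard = m) ≤
      (if m = 1 then 1 / (n : ℝ) else 0) + 32 / (n : ℝ) ^ 2 * (1 / 2) ^ m + E := by
    intro m hm
    rw [hB, Finset.mem_filter, Finset.mem_Icc] at hm
    obtain ⟨⟨hm1, hmn⟩, hdev⟩ := hm
    refine (prob_ncard_oneCore_eq_le hn hmn).trans ?_
    have hpos : 0 < 32 / (n : ℝ) ^ 2 * (1 / 2) ^ m := by positivity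
    rcases hm1.eq_or_lt with rfl | hm2
    · have := occupancyCount_div_le_pow_div hn hk hmn
      simp only [Nat.cast_one, one_pow, Nat.factorial_one, one_mul, pow_one] at this
      rw [if_pos rfl]
      rw [pow_one] at hpos ⊢
      linarith
    rw [if_neg (by omega), zero_add]
    by_cases hsmall : (m : ℝ) ≤ 1 / 18 * n
    · have := (occupancyCount_div_le_pow_div hn hk hmn).trans
        (pow_div_factorial_mul_pow_le hm2 hsmall)
      linarith
    · have hs : η ≤ m / n := by
        rw [le_div_iff₀ hn0]
        push Not at hsmall
        nlinarith
      have hexp : (occupancyCount n (k * m) m : ℝ) / (n : ℝ) ^ (k * m) ≤ E := by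
        refine (occupancyCount_div_le_exp hn hmn).trans ?_
        rw [hE, Real.exp_le_exp]
        refine sub_le_sub_left ?_ _
        have e : (m : ℝ) / n - ν = (m - ν * n) / n := by field_simp
        have hg := hgap _ hs
        rw [e, abs_div, abs_of_pos hn0] at hg
        calc c * (n : ℝ) ^ δ = √n * (c * ((n : ℝ) ^ ((1 : ℝ) / 2 + δ) / n)) := by
              rw [Real.rpow_add hn0, ← Real.sqrt_eq_rpow]
              have := Real.mul_self_sqrt hn0.le
              field_simp
              rw [sq, this]
          _ ≤ √n * (c * (|(m : ℝ) - ν * n| / n)) := by gcongr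
          _ ≤ _ := mul_le_mul_of_nonneg_left hg (Real.sqrt_nonneg _)
      linarith
  refine hunion.trans ((Finset.sum_le_sum hterm).trans ?_)
  have hnonneg : ∀ m : ℕ, 0 ≤ (if m = 1 then 1 / (n : ℝ) else 0) +
      32 / (n : ℝ) ^ 2 * (1 / 2) ^ m + E := by
    intro m
    split_ifs <;> positivity
  refine (Finset.sum_le_sum_of_subset_of_nonneg (Finset.filter_subset _ _)
    fun m _ _ => hnonneg m).trans ?_
  rw [Finset.sum_add_distrib, Finset.sum_add_distrib, ← Finset.mul_sum]
  have hgeom : ∑ m ∈ Finset.Icc 1 n, (1 / 2 : ℝ) ^ m ≤ 2 := by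
    have := (summable_geometric_two).sum_le_tsum (Finset.Icc 1 n) fun _ _ => by positivity
    rwa [tsum_geometric_two] at this
  gcongr
  · rw [Finset.sum_ite_eq']
    split_ifs
    · exact le_rfl
    · positivity
  · calc _ ≤ 32 / (n : ℝ) ^ 2 * 2 := by gcongr
      _ = _ := by ring
  · simp

lemma tendsto_deviation_bound (k : ℕ) {c δ : ℝ} (hc : 0 < c) (hδ : 0 < δ) :
    Tendsto (fun n : ℕ => (n : ℝ) *
      (1 / n + 64 / (n : ℝ) ^ 2 + n * Real.exp (2 * k - c * (n : ℝ) ^ δ))) atTop (nhds 1) := by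
  have h1 : Tendsto (fun n : ℕ => 64 / (n : ℝ)) atTop (nhds 0) :=
    tendsto_const_div_atTop_nhds_zero_nat 64
  have h2 : Tendsto (fun n : ℕ => ((n : ℝ) ^ δ) ^ (2 / δ) * Real.exp (-c * (n : ℝ) ^ δ))
      atTop (nhds 0) :=
    (tendsto_rpow_mul_exp_neg_mul_atTop_nhds_zero (2 / δ) c hc).comp
      ((tendsto_rpow_atTop hδ).comp tendsto_natCast_atTop_atTop)
  have h3 := ((tendsto_const_nhds (x := (1 : ℝ))).add h1).add
    (h2.const_mul (Real.exp (2 * k)))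
  rw [mul_zero, add_zero, add_zero] at h3
  refine h3.congr' ?_
  filter_upwards [eventually_gt_atTop 0] with n hn
  have hn0 : (0 : ℝ) < n := by exact_mod_cast hn
  rw [← Real.rpow_mul hn0.le, mul_div_cancel₀ _ hδ.ne', Real.rpow_two, sub_eq_add_neg,
    Real.exp_add, neg_mul]
  field_simp

/-- Law of large numbers for the one-in-core:
`limsup_n n·P(||𝒞_n| - ν_k n| > n^{1/2+δ}) ≤ 1`; in particular
`|𝒞_n|/n → ν_k` in probability, where `ν_k = τ_k/k`. -/
theorem one_in_core_lln (k : ℕ) (hk : 2 ≤ k) (δ : ℝ) (hδ0 : 0 < δ) (hδ : δ < 1 / 2)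
    (τ : ℝ) (hτpos : 0 < τ) (hτ : 1 - τ / k - Real.exp (-τ) = 0) :
    Filter.limsup (fun n : ℕ => (n : ℝ) *
        prob n k (fun f => (n : ℝ) ^ ((1 : ℝ) / 2 + δ) <
          |((oneCore f).ncard : ℝ) - (τ / k) * n|)) Filter.atTop ≤ 1 ∧
    ∀ ε : ℝ, 0 < ε →
      Filter.Tendsto (fun n : ℕ =>
          prob n k (fun f => ε < |((oneCore f).ncard : ℝ) / n - τ / k|))
        Filter.atTop (nhds 0) := by
  have hk0 : (0 : ℝ) < k := by exact_mod_cast (by omega : 0 < k)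
  have hfix : 1 - τ / k - Real.exp (-(k * (τ / k))) = 0 := by
    rwa [mul_div_cancel₀ _ hk0.ne']
  obtain ⟨c, hc, hbound⟩ := exists_prob_deviation_le hk δ (div_pos hτpos hk0) hfix
  have hlim := tendsto_deviation_bound k hc hδ0
  have hle : ∀ n : ℕ, (n : ℝ) * prob n k (fun f => (n : ℝ) ^ ((1 : ℝ) / 2 + δ) <
      |((oneCore f).ncard : ℝ) - (τ / k) * n|) ≤ (n : ℝ) *
      (1 / n + 64 / (n : ℝ) ^ 2 + n * Real.exp (2 * k - c * (n : ℝ) ^ δ)) := by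
    intro n
    rcases n.eq_zero_or_pos with rfl | hn
    · simp
    · exact mul_le_mul_of_nonneg_left (hbound n hn) (Nat.cast_nonneg n)
  constructor
  · refine (limsup_le_limsup (Eventually.of_forall hle) ?_ hlim.isBoundedUnder_le).trans_eq
      hlim.limsup_eq
    exact isCoboundedUnder_le_of_le atTop (x := 0) fun n =>
      mul_nonneg (Nat.cast_nonneg n) (prob_nonneg _ _ _)
  · intro ε hε
    have hzero : Tendsto (fun n : ℕ => (1 / (n : ℝ)) * ((n : ℝ) *
        (1 / n + 64 / (n : ℝ) ^ 2 + n * Real.exp (2 * k - c * (n : ℝ) ^ δ)))) atTop (nhds 0) := by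
      simpa using (tendsto_const_div_atTop_nhds_zero_nat (1 : ℝ)).mul hlim
    have hsmall : ∀ᶠ n : ℕ in atTop, (n : ℝ) ^ (-(1 / 2 - δ)) ≤ ε :=
      ((tendsto_rpow_neg_atTop (by linarith : 0 < 1 / 2 - δ)).comp
        tendsto_natCast_atTop_atTop).eventually_le_const hε
    refine tendsto_of_tendsto_of_tendsto_of_le_of_le' tendsto_const_nhds hzero
      (Eventually.of_forall fun n => prob_nonneg _ _ _) ?_
    filter_upwards [hsmall, eventually_gt_atTop 0] with n hnε hn
    have hn0 : (0 : ℝ) < n := by exact_mod_cast hn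
    rw [← mul_assoc, one_div_mul_cancel hn0.ne', one_mul]
    refine le_trans (prob_mono fun f hf => ?_) (hbound n hn)
    have e : ((oneCore f).ncard : ℝ) / n - τ / k = ((oneCore f).ncard - τ / k * n) / n := by
      field_simp
    rw [e, abs_div, abs_of_pos hn0, lt_div_iff₀ hn0] at hf
    refine lt_of_le_of_lt ?_ hf
    calc (n : ℝ) ^ ((1 : ℝ) / 2 + δ) = (n : ℝ) ^ (-(1 / 2 - δ)) * n := by
          rw [← Real.rpow_add_one hn0.ne']; congr 1; ring
      _ ≤ ε * n := by gcongr
end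

section
/- Let (k_n) be a sequence of integers with k_n ≥ 2 for all n and k_n − log n → −∞ as n → ∞. Then the probability that the random k_n-out digraph 𝒟_{n,k_n} is strongly connected tends to 0. In fact, with probability tending to 1 there exists a vertex of in-degree zero, i.e. a vertex v such that f(u,i) ≠ v for all u ∈ [n] and i ∈ [k_n]. -/
open scoped Classical
open Filter MeasureTheory

open Finset in
lemma card_filter_forall_notMem {α β : Type*} [Fintype α] [DecidableEq α] [Fintype β]
    (s : Finset β) :
    (univ.filter fun f : α → β => ∀ a, f a ∉ s).card
      = (Fintype.card β - s.card) ^ Fintype.card α := by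
  have h : (univ.filter fun f : α → β => ∀ a, f a ∉ s) = Fintype.piFinset fun _ => sᶜ := by
    ext f; simp
  simp [h, Fintype.card_piFinset, card_compl]

/-- The number of values missed by a function between finite types, as a real number. -/
noncomputable def missedCount {α β : Type*} [Fintype α] [Fintype β] (f : α → β) : ℝ :=
  ∑ v : β, if ∀ a, f a ≠ v then 1 else 0

open Finset in
lemma sum_missedCount (α β : Type*) [Fintype α] [DecidableEq α] [Fintype β] [Nonempty β] :
    ∑ f : α → β, missedCount f
      = Fintype.card β * ((Fintype.card β : ℝ) - 1) ^ Fintype.card α := by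
  have h (v : β) : ∑ f : α → β, (if ∀ a, f a ≠ v then (1 : ℝ) else 0)
      = ((Fintype.card β : ℝ) - 1) ^ Fintype.card α := by
    have := card_filter_forall_notMem (α := α) ({v} : Finset β)
    simp only [mem_singleton, card_singleton] at this
    rw [sum_boole, this, Nat.cast_pow, Nat.cast_sub Fintype.card_pos, Nat.cast_one]
  simp only [missedCount]
  rw [sum_comm, sum_congr rfl fun v _ => h v]
  simp

open Finset in
lemma sum_missedCount_sq (α β : Type*) [Fintype α] [DecidableEq α] [Fintype β]
    (hβ : 2 ≤ Fintype.card β) :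
    ∑ f : α → β, missedCount f ^ 2
      = Fintype.card β * ((Fintype.card β : ℝ) - 1) ^ Fintype.card α
        + Fintype.card β * ((Fintype.card β : ℝ) - 1)
          * ((Fintype.card β : ℝ) - 2) ^ Fintype.card α := by
  have h (v w : β) : ∑ f : α → β,
      ((if ∀ a, f a ≠ v then (1 : ℝ) else 0) * if ∀ a, f a ≠ w then (1 : ℝ) else 0)
      = if v = w then ((Fintype.card β : ℝ) - 1) ^ Fintype.card α
        else ((Fintype.card β : ℝ) - 2) ^ Fintype.card α := by
    have hc := card_filter_forall_notMem (α := α) ({v, w} : Finset β)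
    simp only [mem_insert, mem_singleton, not_or, forall_and] at hc
    simp only [ite_zero_mul_ite_zero, mul_one]
    rw [sum_boole, hc, Nat.cast_pow]
    split_ifs with hvw
    · subst hvw
      rw [pair_eq_singleton, card_singleton, Nat.cast_sub (by omega), Nat.cast_one]
    · rw [card_pair hvw, Nat.cast_sub hβ, Nat.cast_ofNat]
  have hrow (v : β) : ∑ w : β, (if v = w then ((Fintype.card β : ℝ) - 1) ^ Fintype.card α
        else ((Fintype.card β : ℝ) - 2) ^ Fintype.card α)
      = ((Fintype.card β : ℝ) - 1) ^ Fintype.card α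
        + ((Fintype.card β : ℝ) - 1) * ((Fintype.card β : ℝ) - 2) ^ Fintype.card α := by
    rw [← add_sum_erase univ _ (mem_univ v), if_pos rfl,
      sum_congr rfl fun w hw => if_neg (ne_of_mem_erase hw).symm, sum_const, nsmul_eq_mul,
      card_erase_of_mem (mem_univ v), card_univ, Nat.cast_sub (by omega), Nat.cast_one]
  simp only [missedCount, sq, sum_mul_sum]
  rw [sum_comm, sum_congr rfl fun v _ => sum_comm]
  simp only [h, hrow, sum_const, nsmul_eq_mul, card_univ]
  ring

open Finset in
lemma sq_sum_missedCount_le (α β : Type*) [Fintype α] [DecidableEq α] [Fintype β] :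
    (∑ f : α → β, missedCount f) ^ 2
      ≤ (univ.filter fun f : α → β => ∃ v, ∀ a, f a ≠ v).card
        * ∑ f : α → β, missedCount f ^ 2 := by
  have h : ∑ f : α → β with ∃ v, ∀ a, f a ≠ v, missedCount f
      = ∑ f : α → β, missedCount f := by
    refine sum_filter_of_ne fun f _ hf => ?_
    by_contra hne
    push Not at hne
    refine hf (sum_eq_zero fun v _ => if_neg ?_)
    push Not
    exact hne v
  rw [← h]
  refine sq_sum_le_card_mul_sum_sq.trans ?_
  gcongr
  exact filter_subset _ _

/-- Second moment bound: if `μ` is the expected number of missed values, then a uniformly random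
function misses some value with probability at least `μ / (1 + μ)`. -/
lemma div_one_add_le_prob_missed (α β : Type*) [Fintype α] [DecidableEq α] [Fintype β]
    (hβ : 2 ≤ Fintype.card β) {μ : ℝ}
    (hμ : μ = Fintype.card β * (1 - 1 / (Fintype.card β : ℝ)) ^ Fintype.card α) :
    μ / (1 + μ) ≤ ((Finset.univ.filter fun f : α → β => ∃ v, ∀ a, f a ≠ v).card : ℝ)
      / (Fintype.card (α → β) : ℝ) := by
  have : Nonempty β := Fintype.card_pos_iff.mp (by omega)
  have hCS := sq_sum_missedCount_le α β
  rw [sum_missedCount_sq α β hβ, sum_missedCount α β] at hCS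
  rw [Fintype.card_fun, Nat.cast_pow]
  have hn : (2 : ℝ) ≤ Fintype.card β := by exact_mod_cast hβ
  have hC : (0 : ℝ) ≤ (Finset.univ.filter fun f : α → β => ∃ v, ∀ a, f a ≠ v).card := by
    positivity
  generalize ((Finset.univ.filter fun f : α → β => ∃ v, ∀ a, f a ≠ v).card : ℝ) = C at *
  generalize (Fintype.card β : ℝ) = n at *
  generalize Fintype.card α = M at *
  have hn0 : 0 < n := by linarith
  have hT : 0 < n ^ M := by positivity
  have hA : 0 < n * (n - 1) ^ M := mul_pos hn0 (pow_pos (by linarith) M)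
  have hμ' : μ = n * (n - 1) ^ M / n ^ M := by
    rw [hμ, one_sub_div hn0.ne', div_pow, mul_div_assoc]
  have hle : (n - 2) ^ M * n ^ M ≤ (n - 1) ^ M * (n - 1) ^ M := by
    rw [← mul_pow, ← mul_pow]
    exact pow_le_pow_left₀ (mul_nonneg (by linarith) hn0.le) (by nlinarith) M
  have hsq : n * (n - 1) * ((n - 2) ^ M * n ^ M) ≤ (n * (n - 1) ^ M) ^ 2 := by
    calc n * (n - 1) * ((n - 2) ^ M * n ^ M)
        ≤ n * n * ((n - 1) ^ M * (n - 1) ^ M) := by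
          refine mul_le_mul ?_ hle ?_ (by positivity)
          · nlinarith
          · exact mul_nonneg (pow_nonneg (by linarith) M) hT.le
      _ = (n * (n - 1) ^ M) ^ 2 := by ring
  have hfrac : μ / (1 + μ) = n * (n - 1) ^ M / (n ^ M + n * (n - 1) ^ M) := by
    rw [hμ']; field_simp
  rw [hfrac, div_le_div_iff₀ (by positivity) hT]
  generalize n * (n - 1) ^ M = A at *
  refine le_of_mul_le_mul_left ?_ hA
  calc A * (A * n ^ M) = A ^ 2 * n ^ M := by ring
    _ ≤ C * (A + n * (n - 1) * (n - 2) ^ M) * n ^ M := by gcongr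
    _ = C * (A * n ^ M + n * (n - 1) * ((n - 2) ^ M * n ^ M)) := by ring
    _ ≤ C * (A * n ^ M + A ^ 2) := by gcongr
    _ = A * (C * (n ^ M + A)) := by ring

lemma exp_neg_one_mul_le_one_sub_inv_pow {n : ℕ} (hn : 2 ≤ n) :
    Real.exp (-1) * (1 - 1 / (n : ℝ)) ≤ (1 - 1 / (n : ℝ)) ^ n := by
  obtain ⟨m, rfl⟩ : ∃ m, n = m + 1 := ⟨n - 1, by omega⟩
  have hm : (0 : ℝ) < m := by exact_mod_cast (by omega : 0 < m)
  have hx : (1 : ℝ) - 1 / ((m + 1 : ℕ) : ℝ) = (1 + 1 / (m : ℝ))⁻¹ := by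
    push_cast; field_simp; ring
  have hpos : (0 : ℝ) < 1 + 1 / (m : ℝ) := by positivity
  rw [hx, pow_succ, Real.exp_neg, inv_pow]
  gcongr
  calc (1 + 1 / (m : ℝ)) ^ m ≤ Real.exp (1 / (m : ℝ)) ^ m := by
        gcongr
        rw [add_comm]
        exact Real.add_one_le_exp _
    _ = Real.exp 1 := by rw [← Real.exp_nat_mul]; congr 1; field_simp

lemma half_exp_le_mul_one_sub_inv_pow {n k : ℕ} (hn : 2 ≤ n) (hk : 2 * k ≤ n) :
    1 / 2 * Real.exp (Real.log n - k) ≤ n * (1 - 1 / (n : ℝ)) ^ (n * k) := by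
  have hn' : (2 : ℝ) ≤ n := by exact_mod_cast hn
  have hn0 : (0 : ℝ) < n := by linarith
  have hk' : 2 * (k : ℝ) ≤ n := by exact_mod_cast hk
  have hinv : 1 / (n : ℝ) ≤ 1 / 2 := one_div_le_one_div_of_le two_pos hn'
  have hbern : (1 : ℝ) / 2 ≤ (1 - 1 / (n : ℝ)) ^ k := by
    have h := one_add_mul_le_pow (a := -(1 / (n : ℝ))) (by linarith) k
    rw [← sub_eq_add_neg] at h
    refine le_trans ?_ h
    have : (k : ℝ) * (1 / n) ≤ 1 / 2 := by
      rw [mul_one_div, div_le_div_iff₀ hn0 two_pos]; linarith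
    linarith
  have hexp : Real.exp (Real.log n - k) = n * Real.exp (-1) ^ k := by
    rw [sub_eq_add_neg, Real.exp_add, Real.exp_log hn0, ← Real.exp_nat_mul]
    simp
  calc 1 / 2 * Real.exp (Real.log n - k) = n * (Real.exp (-1) ^ k * (1 / 2)) := by
        rw [hexp]; ring
    _ ≤ n * (Real.exp (-1) ^ k * (1 - 1 / (n : ℝ)) ^ k) := by gcongr
    _ = n * (Real.exp (-1) * (1 - 1 / (n : ℝ))) ^ k := by rw [mul_pow]
    _ ≤ n * ((1 - 1 / (n : ℝ)) ^ n) ^ k := by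
        have : 0 ≤ Real.exp (-1) * (1 - 1 / (n : ℝ)) :=
          mul_nonneg (Real.exp_pos _).le (by linarith)
        gcongr
        exact exp_neg_one_mul_le_one_sub_inv_pow hn
    _ = n * (1 - 1 / (n : ℝ)) ^ (n * k) := by rw [pow_mul]

lemma tendsto_expected_missed_atTop (k : ℕ → ℕ)
    (hlim : Tendsto (fun n : ℕ => (k n : ℝ) - Real.log n) atTop atBot) :
    Tendsto (fun n : ℕ => (n : ℝ) * (1 - 1 / (n : ℝ)) ^ (n * k n)) atTop atTop := by
  have hexp : Tendsto (fun n : ℕ => 1 / 2 * Real.exp (Real.log n - k n)) atTop atTop := by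
    refine (Real.tendsto_exp_atTop.comp ?_).const_mul_atTop (by norm_num)
    simpa only [Function.comp_def, neg_sub] using tendsto_neg_atBot_atTop.comp hlim
  refine tendsto_atTop_mono' _ ?_ hexp
  have hlog : ∀ᶠ n : ℕ in atTop, Real.log n ≤ 1 / 2 * n := by
    have h := (Real.isLittleO_log_id_atTop.comp_tendsto tendsto_natCast_atTop_atTop).bound
      (by norm_num : (0 : ℝ) < 1 / 2)
    filter_upwards [h] with n hn
    simpa using (le_abs_self _).trans hn
  filter_upwards [eventually_ge_atTop 2, hlog, hlim.eventually_le_atBot 0] with n hn hl hk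
  refine half_exp_le_mul_one_sub_inv_pow hn ?_
  have : 2 * (k n : ℝ) ≤ n := by linarith
  exact_mod_cast this

lemma prob_le_one (n k : ℕ) (P : (Fin n × Fin k → Fin n) → Prop) : prob n k P ≤ 1 := by
  refine div_le_one_of_le₀ ?_ (by positivity)
  exact_mod_cast Finset.card_le_univ _

lemma prob_add_prob_le_one {n k : ℕ} {P Q : (Fin n × Fin k → Fin n) → Prop}
    (h : ∀ f, P f → ¬ Q f) : prob n k P + prob n k Q ≤ 1 := by
  unfold prob
  rw [← add_div]
  refine div_le_one_of_le₀ ?_ (by positivity)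
  rw [← Nat.cast_add, ← Finset.card_union_of_disjoint (Finset.disjoint_filter.2 fun f _ => h f)]
  exact_mod_cast Finset.card_le_univ _

lemma exists_arc_to_of_strongly_connected {n k : ℕ} (hn : 2 ≤ n) {f : Fin n × Fin k → Fin n}
    (hf : ∀ u v : Fin n, Reaches f u v) (v : Fin n) : ∃ u i, f (u, i) = v := by
  have : Nontrivial (Fin n) := Fin.nontrivial_iff_two_le.2 hn
  obtain ⟨u, hu⟩ := exists_ne v
  obtain h | ⟨w, -, i, hi⟩ := Relation.ReflTransGen.cases_tail (hf u v)
  · exact absurd h.symm hu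
  · exact ⟨w, i, hi⟩


/-- Subcritical phase for strong connectivity: if `k_n - log n → -∞`, then whp
`𝒟_{n,k_n}` has a vertex of in-degree zero; in particular the probability of
strong connectivity tends to `0`. -/
theorem phase_transition_lower (k : ℕ → ℕ) (hk : ∀ n, 2 ≤ k n)
    (hlim : Filter.Tendsto (fun n : ℕ => (k n : ℝ) - Real.log n)
      Filter.atTop Filter.atBot) :
    Filter.Tendsto (fun n : ℕ =>
        prob n (k n) (fun f => ∃ v : Fin n, ∀ (u : Fin n) (i : Fin (k n)), f (u, i) ≠ v))
      Filter.atTop (nhds 1) ∧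
    Filter.Tendsto (fun n : ℕ =>
        prob n (k n) (fun f => ∀ u v : Fin n, Reaches f u v))
      Filter.atTop (nhds 0) := by
  have hzero : Tendsto (fun n : ℕ =>
      prob n (k n) (fun f => ∃ v : Fin n, ∀ (u : Fin n) (i : Fin (k n)), f (u, i) ≠ v))
      atTop (nhds 1) := by
    have hfrac : Tendsto (fun x : ℝ => x / (1 + x)) atTop (nhds 1) := by
      have h : Tendsto (fun x : ℝ => 1 - (1 + x)⁻¹) atTop (nhds (1 - 0)) :=
        tendsto_const_nhds.sub
          (tendsto_inv_atTop_zero.comp (tendsto_atTop_add_const_left _ 1 tendsto_id))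
      rw [sub_zero] at h
      refine h.congr' ?_
      filter_upwards [eventually_gt_atTop 0] with x hx
      field_simp
      ring
    refine tendsto_of_tendsto_of_tendsto_of_le_of_le'
      (hfrac.comp (tendsto_expected_missed_atTop k hlim)) tendsto_const_nhds ?_
      (Eventually.of_forall fun n => prob_le_one n (k n) _)
    filter_upwards [eventually_ge_atTop 2] with n hn
    have h := div_one_add_le_prob_missed (Fin n × Fin (k n)) (Fin n)
      (by simpa using hn) rfl
    simpa [prob, Prod.forall] using h
  refine ⟨hzero, ?_⟩
  have hone := (tendsto_const_nhds (x := (1 : ℝ))).sub hzero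
  rw [sub_self] at hone
  refine tendsto_of_tendsto_of_tendsto_of_le_of_le' tendsto_const_nhds hone
    (Eventually.of_forall fun n => prob_nonneg n (k n) _) ?_
  filter_upwards [eventually_ge_atTop 2] with n hn
  refine le_sub_iff_add_le.2 (prob_add_prob_le_one ?_)
  rintro f hf ⟨v, hv⟩
  obtain ⟨u, i, hui⟩ := exists_arc_to_of_strongly_connected hn hf v
  exact hv u i hui
end

section
/- Let (k_n) be a sequence of integers with k_n ≥ 2 for all n and k_n − log n → +∞ as n → ∞. Then the probability that the random k_n-out digraph 𝒟_{n,k_n} is strongly connected tends to 1. -/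
open scoped Classical
open Filter MeasureTheory

theorem exists_closed_of_not_reaches {n k : ℕ} (f : Fin n × Fin k → Fin n)
    (h : ¬ ∀ u v : Fin n, Reaches f u v) :
    ∃ S : Finset (Fin n), 0 < S.card ∧ S.card < n ∧ ∀ v ∈ S, ∀ i, f (v, i) ∈ S := by
  push Not at h
  obtain ⟨u, v, huv⟩ := h
  refine ⟨Finset.univ.filter (Reaches f u), Finset.card_pos.2 ⟨u, ?_⟩, ?_, ?_⟩
  · exact Finset.mem_filter.2 ⟨Finset.mem_univ u, Relation.ReflTransGen.refl⟩
  · have := Finset.card_lt_card (Finset.filter_ssubset.2 ⟨v, Finset.mem_univ v, huv⟩)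
    simpa using this
  · intro w hw i
    simp only [Finset.mem_filter, Finset.mem_univ, true_and] at hw ⊢
    exact Relation.ReflTransGen.tail hw ⟨i, rfl⟩

theorem card_filter_closed {n k : ℕ} (S : Finset (Fin n)) :
    (Finset.univ.filter fun f : Fin n × Fin k → Fin n => ∀ v ∈ S, ∀ i, f (v, i) ∈ S).card =
      S.card ^ (k * S.card) * n ^ (k * (n - S.card)) := by
  have h : (Finset.univ.filter fun f : Fin n × Fin k → Fin n => ∀ v ∈ S, ∀ i, f (v, i) ∈ S) =
      Fintype.piFinset fun p : Fin n × Fin k => if p.1 ∈ S then S else Finset.univ := by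
    ext f
    simp only [Finset.mem_filter, Finset.mem_univ, true_and, Fintype.mem_piFinset, Prod.forall]
    refine forall_congr' fun v => ?_
    by_cases hv : v ∈ S <;> simp [hv]
  rw [h, Fintype.card_piFinset, Fintype.prod_prod_type]
  have h2 : ∀ v : Fin n, ∏ _i : Fin k, (if v ∈ S then S else Finset.univ).card =
      if v ∈ S then S.card ^ k else n ^ k := by
    intro v
    split_ifs <;> simp
  have hc : (Finset.univ.filter fun v => v ∉ S).card = n - S.card := by
    rw [show (Finset.univ.filter fun v => v ∉ S) = Sᶜ by ext; simp, Finset.card_compl,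
      Fintype.card_fin]
  simp only [h2]
  rw [Finset.prod_ite, Finset.prod_const, Finset.prod_const, hc, ← pow_mul, ← pow_mul]
  simp

theorem prob_eq_card_filter_div {n k : ℕ} (P : (Fin n × Fin k → Fin n) → Prop)
    [DecidablePred P] :
    prob n k P =
      ((Finset.univ.filter P).card : ℝ) / (Fintype.card (Fin n × Fin k → Fin n) : ℝ) := by
  unfold prob
  congr!

theorem prob_closed {n k : ℕ} (hn : 0 < n) (S : Finset (Fin n)) :
    prob n k (fun f => ∀ v ∈ S, ∀ i, f (v, i) ∈ S) =
      ((S.card : ℝ) / n) ^ (k * S.card) := by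
  have hS : S.card ≤ n := by simpa using S.card_le_univ
  have hn' : (n : ℝ) ≠ 0 := by positivity
  rw [prob_eq_card_filter_div, card_filter_closed]
  simp only [Fintype.card_fun, Fintype.card_prod, Fintype.card_fin]
  have : n * k = k * S.card + k * (n - S.card) := by
    rw [← mul_add, Nat.add_sub_cancel' hS, mul_comm]
  rw [this, pow_add]
  push_cast
  rw [mul_div_mul_right _ _ (by positivity), div_pow]

theorem prob_not {n k : ℕ} (hn : 0 < n) (P : (Fin n × Fin k → Fin n) → Prop) :
    prob n k P = 1 - prob n k (fun f => ¬ P f) := by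
  have : Nonempty (Fin n) := ⟨⟨0, hn⟩⟩
  have h := Finset.card_filter_add_card_filter_not (s := Finset.univ) P
  have hc : (Fintype.card (Fin n × Fin k → Fin n) : ℝ) ≠ 0 := by
    exact_mod_cast Fintype.card_ne_zero
  rw [eq_sub_iff_add_eq, prob_eq_card_filter_div, prob_eq_card_filter_div, ← add_div, div_eq_one_iff_eq hc]
  exact_mod_cast h

theorem prob_not_reaches_le {n k : ℕ} (hn : 0 < n) :
    prob n k (fun f => ¬ ∀ u v : Fin n, Reaches f u v) ≤
      ∑ s ∈ Finset.range (n + 1),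
        if 0 < s ∧ s < n then (n.choose s : ℝ) * ((s : ℝ) / n) ^ (k * s) else 0 := by
  let T : Finset (Finset (Fin n)) :=
    Finset.univ.powerset.filter fun S => 0 < S.card ∧ S.card < n
  have hsub : (Finset.univ.filter fun f : Fin n × Fin k → Fin n =>
      ¬ ∀ u v : Fin n, Reaches f u v) ⊆
      T.biUnion fun S => Finset.univ.filter fun f => ∀ v ∈ S, ∀ i, f (v, i) ∈ S := by
    intro f hf
    obtain ⟨S, h0, h1, h2⟩ := exists_closed_of_not_reaches f (Finset.mem_filter.1 hf).2
    simp only [Finset.mem_biUnion, Finset.mem_filter, Finset.mem_univ, true_and]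
    exact ⟨S, by simp [T, Finset.card_pos.1 h0, h1], h2⟩
  have hcard := (Finset.card_le_card hsub).trans Finset.card_biUnion_le
  calc prob n k (fun f => ¬ ∀ u v : Fin n, Reaches f u v)
      ≤ ∑ S ∈ T, prob n k (fun f => ∀ v ∈ S, ∀ i, f (v, i) ∈ S) := by
        simp only [prob_eq_card_filter_div]
        rw [← Finset.sum_div]
        gcongr
        exact_mod_cast hcard
    _ = ∑ S ∈ (Finset.univ : Finset (Fin n)).powerset,
          if 0 < S.card ∧ S.card < n then ((S.card : ℝ) / n) ^ (k * S.card) else 0 := by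
        rw [Finset.sum_filter]
        simp only [prob_closed hn]
    _ = _ := by
        rw [Finset.sum_powerset_apply_card
          (fun s => if 0 < s ∧ s < n then ((s : ℝ) / n) ^ (k * s) else 0)]
        simp

theorem choose_le_exp {n m : ℕ} (hm : 0 < m) (hmn : m ≤ n) :
    (n.choose m : ℝ) ≤ Real.exp (m * (1 + Real.log n - Real.log m)) := by
  have hm' : (0 : ℝ) < m := by exact_mod_cast hm
  have hn' : (0 : ℝ) < n := by exact_mod_cast hm.trans_le hmn
  have he : Real.exp (m * (1 + Real.log n - Real.log m)) =
      Real.exp m * ((n : ℝ) ^ m / (m : ℝ) ^ m) := by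
    rw [mul_sub, mul_add, mul_one, Real.exp_sub, Real.exp_add, Real.exp_nat_mul (Real.log n),
      Real.exp_nat_mul (Real.log m), Real.exp_log hn', Real.exp_log hm', mul_div_assoc]
  calc (n.choose m : ℝ) ≤ (n : ℝ) ^ m / (m.factorial : ℝ) := Nat.choose_le_pow_div m n
    _ = (m : ℝ) ^ m / (m.factorial : ℝ) * ((n : ℝ) ^ m / (m : ℝ) ^ m) := by field_simp
    _ ≤ Real.exp m * ((n : ℝ) ^ m / (m : ℝ) ^ m) := by
        gcongr
        exact Real.pow_div_factorial_le_exp _ hm'.le m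
    _ = _ := he.symm

theorem choose_mul_pow_le_of_small {n s k : ℕ} {w : ℝ} (hs : 0 < s) (hsn : 2 * s ≤ n)
    (hk : Real.log n + w ≤ k) (hk1 : 1 ≤ k) :
    (n.choose s : ℝ) * ((s : ℝ) / n) ^ (k * s) ≤ Real.exp (2 - w / 2) ^ s := by
  have hs' : (0 : ℝ) < s := by exact_mod_cast hs
  have hn' : (0 : ℝ) < n := by exact_mod_cast (by omega : 0 < n)
  have hpow : ((s : ℝ) / n) ^ (k * s) =
      Real.exp (s * (k * (Real.log s - Real.log n))) := by
    rw [Real.exp_nat_mul, Real.exp_nat_mul, ← Real.log_div hs'.ne' hn'.ne',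
      Real.exp_log (by positivity), pow_mul]
  have hgap : 1 / 2 ≤ Real.log n - Real.log s := by
    rw [← Real.log_div hn'.ne' hs'.ne']
    have h2 : (2 : ℝ) ≤ n / s := by
      rw [le_div_iff₀ hs']
      exact_mod_cast hsn
    have := Real.log_le_log (by norm_num) h2
    linarith [Real.log_two_gt_d9]
  have hk1' : (1 : ℝ) ≤ k := by exact_mod_cast hk1
  have hlog : 0 ≤ Real.log n := Real.log_natCast_nonneg n
  rw [hpow, ← Real.exp_nat_mul]
  refine (mul_le_mul_of_nonneg_right (choose_le_exp hs (by omega)) (Real.exp_pos _).le).trans ?_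
  rw [← Real.exp_add, ← mul_add]
  refine Real.exp_le_exp.2 (mul_le_mul_of_nonneg_left ?_ hs'.le)
  nlinarith [mul_le_mul_of_nonneg_left hgap (sub_nonneg.2 hk1')]

theorem choose_mul_pow_le_of_large {n t k : ℕ} {w : ℝ} (ht : 0 < t) (htn : 2 * t ≤ n)
    (hw : 0 ≤ w) (hk : Real.log n + w ≤ k) :
    (n.choose (n - t) : ℝ) * (((n - t : ℕ) : ℝ) / n) ^ (k * (n - t)) ≤
      Real.exp (2 - w / 2) ^ t := by
  have ht' : (1 : ℝ) ≤ t := by exact_mod_cast ht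
  have hn' : (0 : ℝ) < n := by exact_mod_cast (by omega : 0 < n)
  have htn' : 2 * (t : ℝ) ≤ n := by exact_mod_cast htn
  have hle : t ≤ n := by omega
  set x : ℝ := t / n with hx
  have hx0 : 0 < x := by positivity
  have hx2 : x ≤ 1 / 2 := by
    rw [hx, div_le_iff₀ hn']
    linarith
  have hxn : x * n = t := div_mul_cancel₀ _ hn'.ne'
  have hbase : ((n - t : ℕ) : ℝ) / n = 1 - x := by
    rw [Nat.cast_sub hle, sub_div, div_self hn'.ne']
  have hpow : (1 - x) ^ (k * (n - t)) ≤ Real.exp (t * (-(k * (1 - x)))) := by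
    calc (1 - x) ^ (k * (n - t)) ≤ Real.exp (-x) ^ (k * (n - t)) :=
          pow_le_pow_left₀ (by linarith) (Real.one_sub_le_exp_neg x) _
      _ = Real.exp (t * (-(k * (1 - x)))) := by
          rw [← Real.exp_nat_mul, Nat.cast_mul, Nat.cast_sub hle, ← hxn]
          ring_nf
  have hlog : x * Real.log n ≤ 1 + Real.log t := by
    have h1 : Real.log n = Real.log t - Real.log x := by
      rw [hx, Real.log_div (by positivity) hn'.ne']
      ring
    have h2 : -Real.log x ≤ 1 / x := by
      rw [← Real.log_inv, one_div]
      linarith [Real.log_le_sub_one_of_pos (inv_pos.2 hx0)]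
    have h3 : x * -Real.log x ≤ 1 := by
      calc x * -Real.log x ≤ x * (1 / x) := mul_le_mul_of_nonneg_left h2 hx0.le
        _ = 1 := by field_simp
    have h4 : 0 ≤ Real.log t := Real.log_nonneg ht'
    rw [h1]
    nlinarith
  rw [Nat.choose_symm hle, hbase, ← Real.exp_nat_mul]
  refine (mul_le_mul (choose_le_exp ht hle) hpow (by bound) (Real.exp_pos _).le).trans ?_
  rw [← Real.exp_add, ← mul_add]
  refine Real.exp_le_exp.2 (mul_le_mul_of_nonneg_left ?_ (by positivity))
  nlinarith [mul_le_mul_of_nonneg_right hk (by linarith : 0 ≤ 1 - x),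
    mul_le_mul_of_nonneg_left hx2 hw]

theorem prob_not_reaches_le_geometric {n k : ℕ} {w : ℝ} (hn : 0 < n) (hw : 0 ≤ w)
    (hk : Real.log n + w ≤ k) (hk1 : 1 ≤ k) (hq : Real.exp (2 - w / 2) < 1) :
    prob n k (fun f => ¬ ∀ u v : Fin n, Reaches f u v) ≤
      2 * (Real.exp (2 - w / 2) * (1 - Real.exp (2 - w / 2))⁻¹) := by
  set q := Real.exp (2 - w / 2) with hqdef
  have hq0 : 0 < q := Real.exp_pos _
  have hgeom : ∑ i ∈ Finset.range (n + 1), (if 0 < i then q ^ i else 0) ≤ q * (1 - q)⁻¹ := by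
    rw [Finset.sum_range_succ']
    simp only [Nat.succ_pos, if_true, lt_irrefl, if_false, add_zero, pow_succ']
    rw [← Finset.mul_sum]
    gcongr
    rw [← tsum_geometric_of_lt_one hq0.le hq]
    exact (summable_geometric_of_lt_one hq0.le hq).sum_le_tsum _ fun _ _ => by positivity
  calc prob n k (fun f => ¬ ∀ u v : Fin n, Reaches f u v)
      ≤ ∑ s ∈ Finset.range (n + 1), ((if 0 < s then q ^ s else 0) +
          if 0 < n - s then q ^ (n - s) else 0) := by
        refine (prob_not_reaches_le hn).trans (Finset.sum_le_sum fun s _ => ?_)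
        by_cases hs : 0 < s ∧ s < n
        · rw [if_pos hs, if_pos hs.1, if_pos (Nat.sub_pos_of_lt hs.2)]
          by_cases h2 : 2 * s ≤ n
          · exact (choose_mul_pow_le_of_small hs.1 h2 hk hk1).trans
              (le_add_of_nonneg_right (by positivity))
          · have := choose_mul_pow_le_of_large (t := n - s) (by omega) (by omega) hw hk
            rw [Nat.sub_sub_self hs.2.le] at this
            exact this.trans (le_add_of_nonneg_left (by positivity))
        · rw [if_neg hs]
          positivity
    _ = 2 * ∑ i ∈ Finset.range (n + 1), (if 0 < i then q ^ i else 0) := by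
        rw [Finset.sum_add_distrib, two_mul]
        congr 1
        rw [← Finset.sum_range_reflect]
        refine Finset.sum_congr rfl fun i hi => ?_
        have : n - (n + 1 - 1 - i) = i := by
          have := Finset.mem_range.1 hi
          omega
        rw [this]
    _ ≤ _ := by gcongr

/-- Supercritical phase for strong connectivity: if `k_n - log n → +∞`, then whp
`𝒟_{n,k_n}` is strongly connected. -/
theorem phase_transition_upper (k : ℕ → ℕ) (hk : ∀ n, 2 ≤ k n)
    (hlim : Filter.Tendsto (fun n : ℕ => (k n : ℝ) - Real.log n)
      Filter.atTop Filter.atTop) :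
    Filter.Tendsto (fun n : ℕ =>
        prob n (k n) (fun f => ∀ u v : Fin n, Reaches f u v))
      Filter.atTop (nhds 1) := by
  have hq : Tendsto (fun n : ℕ => Real.exp (2 - ((k n : ℝ) - Real.log n) / 2)) atTop (nhds 0) :=
    Real.tendsto_exp_atBot.comp
      (tendsto_atBot_add_const_left _ 2 (tendsto_neg_atTop_atBot.comp
        (hlim.atTop_div_const two_pos)))
  have hb : Tendsto (fun n : ℕ => 2 * (Real.exp (2 - ((k n : ℝ) - Real.log n) / 2) *
      (1 - Real.exp (2 - ((k n : ℝ) - Real.log n) / 2))⁻¹)) atTop (nhds 0) := by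
    have := (hq.mul ((hq.const_sub 1).inv₀ (by norm_num))).const_mul 2
    simpa using this
  have hbad : Tendsto (fun n : ℕ => prob n (k n) (fun f => ¬ ∀ u v : Fin n, Reaches f u v))
      atTop (nhds 0) := by
    refine tendsto_of_tendsto_of_tendsto_of_le_of_le' tendsto_const_nhds hb
      (Eventually.of_forall fun n => by unfold prob; positivity) ?_
    filter_upwards [eventually_gt_atTop 0, hlim.eventually_ge_atTop 0,
      hq.eventually_lt_const one_pos] with n hn hw hq1
    exact prob_not_reaches_le_geometric hn hw (by linarith) (by linarith [hk n]) hq1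
  have h1 := hbad.const_sub 1
  rw [sub_zero] at h1
  refine h1.congr' ?_
  filter_upwards [eventually_gt_atTop 0] with n hn
  exact (prob_not hn _).symm
end

section
/- Fix an integer k ≥ 2. In the random k-out digraph 𝒟_{n,k}, let S_n = #{(v,i) ∈ [n]×[k] : f(v,i) = v} be the number of self-loops, and M_n = #{(v,i,j) : v ∈ [n], 1 ≤ i < j ≤ k, f(v,i) = f(v,j)} be the number of coinciding arc pairs. Let (S,M) be a pair of independent Poisson random variables with means k and k(k−1)/2 respectively. Then the total variation distance between the distribution of (S_n, M_n) on ℕ×ℕ and the distribution of (S,M) is O(1/n): there is a constant C (depending only on k) such that for all n ≥ 1, sup_{A ⊆ ℕ×ℕ} |P((S_n,M_n) ∈ A) − P((S,M) ∈ A)| ≤ C/n. -/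
open scoped Classical
open Filter MeasureTheory

/-- The number of self-loops of `𝒟_{n,k}`. -/
noncomputable def numLoops {n k : ℕ} (f : Fin n × Fin k → Fin n) : ℕ :=
  (Finset.univ.filter fun p : Fin n × Fin k => f p = p.1).card

/-- The number of coinciding arc pairs `(v, i, j)`, `i < j`, `f(v,i) = f(v,j)`. -/
noncomputable def numMulti {n k : ℕ} (f : Fin n × Fin k → Fin n) : ℕ :=
  (Finset.univ.filter fun t : Fin n × Fin k × Fin k =>
    t.2.1 < t.2.2 ∧ f (t.1, t.2.1) = f (t.1, t.2.2)).card

/-- The law of a pair of independent Poisson random variables with means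
`lam1` and `lam2`, evaluated on a set `A ⊆ ℕ × ℕ`. -/
noncomputable def poissonPairProb (lam1 lam2 : ℝ) (A : Set (ℕ × ℕ)) : ℝ :=
  ∑' p : ℕ × ℕ, if p ∈ A then
    (Real.exp (-lam1) * lam1 ^ p.1 / (Nat.factorial p.1)) *
      (Real.exp (-lam2) * lam2 ^ p.2 / (Nat.factorial p.2)) else 0

open scoped BoundedContinuousFunction

/-- Bounded real functions on `ℕ × ℕ`, with the supremum norm. -/
def BoundedFun : Type := ℕ × ℕ →ᵇ ℝ

namespace BoundedFun

noncomputable instance : NormedAddCommGroup BoundedFun :=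
  inferInstanceAs (NormedAddCommGroup (ℕ × ℕ →ᵇ ℝ))

noncomputable instance : NormedSpace ℝ BoundedFun :=
  inferInstanceAs (NormedSpace ℝ (ℕ × ℕ →ᵇ ℝ))

instance : CompleteSpace BoundedFun := inferInstanceAs (CompleteSpace (ℕ × ℕ →ᵇ ℝ))

instance : FunLike BoundedFun (ℕ × ℕ) ℝ := inferInstanceAs (FunLike (ℕ × ℕ →ᵇ ℝ) (ℕ × ℕ) ℝ)

@[ext]
theorem ext {g h : BoundedFun} (H : ∀ x, g x = h x) : g = h := DFunLike.ext g h H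

/-- Evaluation at a point. -/
noncomputable def evalAt (x : ℕ × ℕ) : BoundedFun →L[ℝ] ℝ :=
  BoundedContinuousFunction.evalCLM (α := ℕ × ℕ) (β := ℝ) ℝ x

@[simp]
theorem evalAt_apply (x : ℕ × ℕ) (g : BoundedFun) : evalAt x g = g x := rfl

theorem norm_apply_le (g : BoundedFun) (x : ℕ × ℕ) : ‖g x‖ ≤ ‖g‖ :=
  BoundedContinuousFunction.norm_coe_le_norm (α := ℕ × ℕ) (β := ℝ) g x

theorem norm_le {g : BoundedFun} {c : ℝ} (hc : 0 ≤ c) : ‖g‖ ≤ c ↔ ∀ x, ‖g x‖ ≤ c :=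
  BoundedContinuousFunction.norm_le (α := ℕ × ℕ) (β := ℝ) hc

/-- The indicator function of `A`. -/
noncomputable def indicator (A : Set (ℕ × ℕ)) : BoundedFun :=
  BoundedContinuousFunction.ofNormedAddCommGroupDiscrete (fun p => if p ∈ A then 1 else 0) 1
    fun p => by split_ifs <;> simp

theorem indicator_apply (A : Set (ℕ × ℕ)) (p : ℕ × ℕ) :
    indicator A p = if p ∈ A then 1 else 0 := rfl

instance : Nontrivial BoundedFun :=
  ⟨⟨indicator Set.univ, 0, fun h => by
    have h0 := (congrArg (evalAt 0) h).trans (map_zero _)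
    simp [indicator_apply] at h0⟩⟩

theorem norm_indicator_le (A : Set (ℕ × ℕ)) : ‖indicator A‖ ≤ 1 := by
  refine (norm_le zero_le_one).2 fun p => ?_
  rw [indicator_apply]
  split_ifs <;> simp

theorem abs_apply_indicator_le (T : BoundedFun →L[ℝ] BoundedFun) (A : Set (ℕ × ℕ))
    (x : ℕ × ℕ) : |T (indicator A) x| ≤ ‖T‖ :=
  (norm_apply_le _ x).trans ((T.le_opNorm _).trans
    (mul_le_of_le_one_right (norm_nonneg _) (norm_indicator_le A)))

end BoundedFun

/-- Translation by `p`, acting on bounded functions on `ℕ × ℕ`. -/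
noncomputable def shift (p : ℕ × ℕ) : BoundedFun →L[ℝ] BoundedFun :=
  LinearMap.mkContinuous
    { toFun := fun g => BoundedContinuousFunction.compContinuous (α := ℕ × ℕ) (β := ℝ) g
        ⟨fun x => x + p, continuous_of_discreteTopology⟩
      map_add' := fun _ _ => rfl
      map_smul' := fun _ _ => rfl } 1 fun g => by
    rw [one_mul]
    exact (BoundedFun.norm_le (norm_nonneg g)).2 fun x => g.norm_apply_le _

@[simp]
theorem shift_apply (p : ℕ × ℕ) (g : BoundedFun) (x : ℕ × ℕ) : shift p g x = g (x + p) := rfl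

theorem norm_shift_le (p : ℕ × ℕ) : ‖shift p‖ ≤ 1 :=
  LinearMap.mkContinuous_norm_le _ zero_le_one _

theorem shift_zero : shift 0 = 1 := by
  ext g x
  simp

theorem shift_add (p q : ℕ × ℕ) : shift (p + q) = shift p * shift q := by
  ext g x
  simp [add_assoc]

theorem shift_nsmul (m : ℕ) (p : ℕ × ℕ) : shift (m • p) = shift p ^ m := by
  induction m with
  | zero => simp [shift_zero]
  | succ m ih => rw [succ_nsmul, shift_add, ih, pow_succ]

theorem shift_eq_mul (p : ℕ × ℕ) : shift p = shift (1, 0) ^ p.1 * shift (0, 1) ^ p.2 := by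
  rw [← shift_nsmul, ← shift_nsmul, ← shift_add]
  congr 1
  ext <;> simp

theorem shift_commute (p q : ℕ × ℕ) : Commute (shift p) (shift q) := by
  rw [Commute, SemiconjBy, ← shift_add, ← shift_add, add_comm]

/-- `shift` as a homomorphism of monoids. -/
noncomputable def shiftHom : Multiplicative (ℕ × ℕ) →* (BoundedFun →L[ℝ] BoundedFun) where
  toFun p := shift p.toAdd
  map_one' := shift_zero
  map_mul' p q := shift_add p.toAdd q.toAdd

section BanachAlgebra

variable {R : Type*} [NormedRing R] [NormOneClass R]

theorem norm_prod_map_sub_pow_le {α : Type*} (T : α → R) (U : R) (ε : ℝ)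
    (hT : ∀ a, ‖T a‖ ≤ 1) (hU : ‖U‖ ≤ 1) (hTU : ∀ a, ‖T a - U‖ ≤ ε) (l : List α) :
    ‖(l.map T).prod - U ^ l.length‖ ≤ l.length * ε := by
  induction l with
  | nil => simp
  | cons a l ih =>
    have hpow : ‖U ^ l.length‖ ≤ 1 := (norm_pow_le U _).trans (pow_le_one₀ (norm_nonneg _) hU)
    have hsplit : ((a :: l).map T).prod - U ^ (a :: l).length
        = (T a - U) * U ^ l.length + T a * ((l.map T).prod - U ^ l.length) := by
      simp only [List.map_cons, List.prod_cons, List.length_cons, pow_succ']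
      noncomm_ring
    rw [hsplit]
    calc _ ≤ ‖T a - U‖ * ‖U ^ l.length‖ + ‖T a‖ * ‖(l.map T).prod - U ^ l.length‖ :=
          (norm_add_le _ _).trans (add_le_add (norm_mul_le _ _) (norm_mul_le _ _))
      _ ≤ ε * 1 + 1 * (l.length * ε) := by
          have hε : 0 ≤ ε := (norm_nonneg _).trans (hTU a)
          gcongr
          exacts [hTU a, hT a]
      _ = _ := by push_cast [List.length_cons]; ring

variable [NormedAlgebra ℝ R] [CompleteSpace R]

theorem norm_exp_le_exp_norm (x : R) : ‖NormedSpace.exp x‖ ≤ Real.exp ‖x‖ := by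
  have h := NormedSpace.exp_series_hasSum_exp' (𝕂 := ℝ) x
  have h' := NormedSpace.exp_series_hasSum_exp' (𝕂 := ℝ) ‖x‖
  rw [← Real.exp_eq_exp_ℝ] at h'
  refine h.norm_le_of_bounded h' fun i => ?_
  rw [norm_smul, smul_eq_mul, Real.norm_of_nonneg (by positivity)]
  gcongr
  exact norm_pow_le x i

theorem norm_exp_sub_one_sub_self_le (x : R) :
    ‖NormedSpace.exp x - 1 - x‖ ≤ ‖x‖ ^ 2 * Real.exp ‖x‖ := by
  have h := (hasSum_nat_add_iff' 2).2 (NormedSpace.exp_series_hasSum_exp' (𝕂 := ℝ) x)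
  have h' := (NormedSpace.exp_series_hasSum_exp' (𝕂 := ℝ) ‖x‖).mul_left (‖x‖ ^ 2)
  rw [← Real.exp_eq_exp_ℝ] at h'
  simp only [Finset.sum_range_succ, Finset.sum_range_zero, Nat.factorial, pow_zero, pow_one,
    Nat.cast_one, inv_one, one_smul, zero_add, mul_one, ← sub_sub] at h
  refine h.norm_le_of_bounded h' fun i => ?_
  rw [norm_smul, smul_eq_mul, Real.norm_of_nonneg (by positivity)]
  calc ((i + 2).factorial : ℝ)⁻¹ * ‖x ^ (i + 2)‖ ≤ (i.factorial : ℝ)⁻¹ * ‖x‖ ^ (i + 2) := by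
        gcongr
        · omega
        · exact norm_pow_le x _
    _ = _ := by ring

end BanachAlgebra

/-- The generator whose exponential is convolution with a pair of independent Poisson variables. -/
noncomputable def poissonGen (a b : ℝ) : BoundedFun →L[ℝ] BoundedFun :=
  a • (shift (1, 0) - 1) + b • (shift (0, 1) - 1)

theorem norm_poissonGen_le {a b : ℝ} (ha : 0 ≤ a) (hb : 0 ≤ b) :
    ‖poissonGen a b‖ ≤ 2 * (a + b) := by
  have h (p : ℕ × ℕ) : ‖shift p - 1‖ ≤ 2 := by
    refine (norm_sub_le _ _).trans ?_
    have := norm_shift_le p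
    rw [norm_one]
    linarith
  calc _ ≤ ‖a • (shift (1, 0) - 1)‖ + ‖b • (shift (0, 1) - 1)‖ := norm_add_le _ _
    _ = a * ‖shift (1, 0) - 1‖ + b * ‖shift (0, 1) - 1‖ := by
        rw [norm_smul, norm_smul, Real.norm_of_nonneg ha, Real.norm_of_nonneg hb]
    _ ≤ a * 2 + b * 2 := by gcongr <;> exact h _
    _ = _ := by ring

theorem exp_poissonGen (a b : ℝ) : NormedSpace.exp (poissonGen a b) =
    Real.exp (-(a + b)) •
      (NormedSpace.exp (a • shift (1, 0)) * NormedSpace.exp (b • shift (0, 1))) := by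
  have hA : poissonGen a b = algebraMap ℝ _ (-(a + b)) +
      (a • shift (1, 0) + b • shift (0, 1)) := by
    rw [Algebra.algebraMap_eq_smul_one, poissonGen]
    module
  let _ := NormedAlgebra.restrictScalars ℚ ℝ (BoundedFun →L[ℝ] BoundedFun)
  rw [hA, NormedSpace.exp_add_of_commute (Algebra.commutes _ _),
    NormedSpace.exp_add_of_commute (((shift_commute _ _).smul_left _).smul_right _),
    ← NormedSpace.algebraMap_exp_comm, ← Real.exp_eq_exp_ℝ, Algebra.algebraMap_eq_smul_one,
    smul_one_mul]

theorem norm_exp_poissonGen_le_one {a b : ℝ} (ha : 0 ≤ a) (hb : 0 ≤ b) :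
    ‖NormedSpace.exp (poissonGen a b)‖ ≤ 1 := by
  have h (c : ℝ) (hc : 0 ≤ c) (p : ℕ × ℕ) : ‖NormedSpace.exp (c • shift p)‖ ≤ Real.exp c := by
    refine (norm_exp_le_exp_norm _).trans (Real.exp_le_exp.2 ?_)
    rw [norm_smul, Real.norm_of_nonneg hc]
    exact mul_le_of_le_one_right hc (norm_shift_le p)
  rw [exp_poissonGen, norm_smul, Real.norm_of_nonneg (Real.exp_pos _).le]
  calc _ ≤ Real.exp (-(a + b)) * (Real.exp a * Real.exp b) := by
        gcongr
        refine (norm_mul_le _ _).trans ?_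
        gcongr
        exacts [h a ha _, h b hb _]
    _ = 1 := by rw [← Real.exp_add, ← Real.exp_add]; simp

theorem poissonPairProb_eq_exp_apply (a b : ℝ) (A : Set (ℕ × ℕ)) :
    poissonPairProb a b A = NormedSpace.exp (poissonGen a b) (BoundedFun.indicator A) 0 := by
  have hs (c : ℝ) (p : ℕ × ℕ) := NormedSpace.exp_series_hasSum_exp' (𝕂 := ℝ) (c • shift p)
  have hn (c : ℝ) (p : ℕ × ℕ) := NormedSpace.norm_expSeries_summable' (𝕂 := ℝ) (c • shift p)
  have hprod := (summable_mul_of_summable_norm (hn a (1, 0)) (hn b (0, 1))).hasSum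
  rw [← tsum_mul_tsum_of_summable_norm (hn a (1, 0)) (hn b (0, 1)), (hs _ _).tsum_eq,
    (hs _ _).tsum_eq] at hprod
  have hexp := hprod.const_smul (Real.exp (-(a + b)))
  rw [← exp_poissonGen] at hexp
  have hev := (hexp.mapL (ContinuousLinearMap.apply ℝ _ (BoundedFun.indicator A))).mapL
    (BoundedFun.evalAt 0)
  refine (tsum_congr fun p => ?_).trans hev.tsum_eq
  have hterm : ((p.1.factorial : ℝ)⁻¹ • (a • shift (1, 0)) ^ p.1) *
      ((p.2.factorial : ℝ)⁻¹ • (b • shift (0, 1)) ^ p.2) =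
      ((p.1.factorial : ℝ)⁻¹ * a ^ p.1 * ((p.2.factorial : ℝ)⁻¹ * b ^ p.2)) • shift p := by
    rw [shift_eq_mul p, smul_pow, smul_pow, smul_smul, smul_smul, smul_mul_smul_comm]
  rw [hterm]
  simp only [ContinuousLinearMap.apply_apply, BoundedFun.evalAt_apply,
    map_smul, shift_apply, zero_add,
    BoundedFun.indicator_apply, smul_eq_mul]
  split_ifs
  · rw [neg_add, Real.exp_add]
    ring
  · simp

section Resampling

variable {ι α : Type*} [Fintype ι] [DecidableEq ι] [Fintype α]

theorem card_mul_sum_eq_sum_update (i : ι) (F : (ι → α) → ℝ) :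
    Fintype.card α * ∑ h, F h = ∑ h, ∑ a, F (Function.update h i a) := by
  have hinv : Function.Involutive
      fun p : (ι → α) × α => (Function.update p.1 i p.2, p.1 i) := fun p => by simp
  have h := Equiv.sum_comp hinv.toPerm fun p => F p.1
  simp only [Function.Involutive.coe_toPerm, Fintype.sum_prod_type] at h
  rw [h]
  simp [Finset.mul_sum]

/-- The value at an element of `ι`, or the fixed value `v` at `none`. -/
def extendBy (v : α) (h : ι → α) (s : Option ι) : α := s.elim v h

omit [Fintype ι] [Fintype α] in
theorem extendBy_update {v : α} {h : ι → α} {i : ι} {s : Option ι} (hs : s ≠ some i) (a : α) :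
    extendBy v (Function.update h i a) s = extendBy v h s := by
  cases s with
  | none => rfl
  | some j => exact Function.update_of_ne (fun e => hs (congrArg some e)) _ _

variable [DecidableEq α]

theorem card_mul_card_filter_eq_extendBy (v : α) {i : ι} {s : Option ι} (hs : s ≠ some i) :
    (Fintype.card α : ℝ) * (Finset.univ.filter fun h : ι → α => h i = extendBy v h s).card =
      Fintype.card (ι → α) := by
  rw [← Finset.sum_boole, card_mul_sum_eq_sum_update i]
  simp [extendBy_update hs]

theorem card_sq_mul_card_filter_eq_extendBy (v : α) {i j : ι} (hij : i ≠ j) {s t : Option ι}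
    (hsi : s ≠ some i) (hsj : s ≠ some j) (hti : t ≠ some i) (htj : t ≠ some j) :
    (Fintype.card α : ℝ) ^ 2 * (Finset.univ.filter fun h : ι → α =>
      h i = extendBy v h s ∧ h j = extendBy v h t).card = Fintype.card (ι → α) := by
  rw [← Finset.sum_boole, sq, mul_assoc, card_mul_sum_eq_sum_update i,
    card_mul_sum_eq_sum_update j]
  simp [extendBy_update hsi, extendBy_update hsj, extendBy_update hti, extendBy_update htj,
    Function.update_of_ne hij.symm, ite_and]

end Resampling

section LocalCount

variable {α : Type*} [DecidableEq α] {k : ℕ}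

/-- The indices of the arcs out of `v` that are loops. -/
def loopSet (v : α) (h : Fin k → α) : Finset (Fin k) :=
  Finset.univ.filter fun i => h i = v

/-- The pairs of indices of coinciding arcs. -/
def multiSet (h : Fin k → α) : Finset (Fin k × Fin k) :=
  Finset.univ.filter fun p => p.1 < p.2 ∧ h p.1 = h p.2

/-- The numbers of loops and of coinciding pairs among the arcs out of `v`. -/
def localCount (v : α) (h : Fin k → α) : ℕ × ℕ := ((loopSet v h).card, (multiSet h).card)

theorem exists_two_repeats {v : α} {h : Fin k → α}
    (hc : 2 ≤ (localCount v h).1 + (localCount v h).2) :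
    ∃ i j : Fin k, i ≠ j ∧ ∃ s t : Option (Fin k),
      (s ≠ some i ∧ s ≠ some j ∧ t ≠ some i ∧ t ≠ some j) ∧
      h i = extendBy v h s ∧ h j = extendBy v h t := by
  by_cases hl : 2 ≤ (loopSet v h).card
  · obtain ⟨i, hi, j, hj, hij⟩ := Finset.one_lt_card.1 hl
    simp only [loopSet, Finset.mem_filter, Finset.mem_univ, true_and] at hi hj
    exact ⟨i, j, hij, none, none, by simp, hi, hj⟩
  by_cases hm : 2 ≤ (multiSet h).card
  · obtain ⟨⟨a, b⟩, h1, ⟨c, d⟩, h2, hne⟩ := Finset.one_lt_card.1 hm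
    simp only [multiSet, Finset.mem_filter, Finset.mem_univ, true_and] at h1 h2
    obtain ⟨hab, eab⟩ := h1
    obtain ⟨hcd, ecd⟩ := h2
    rw [Ne, Prod.mk.injEq] at hne
    by_cases hac : a = c
    · exact ⟨b, d, by grind, some a, some a, by grind, eab.symm, by grind [extendBy]⟩
    by_cases hbd : b = d
    · exact ⟨a, c, hac, some b, some b, by grind, eab, by grind [extendBy]⟩
    by_cases had : a = d
    · exact ⟨b, c, by grind, some a, some a, by grind, eab.symm, by grind [extendBy]⟩
    by_cases hbc : b = c
    · exact ⟨a, d, had, some b, some b, by grind, eab, by grind [extendBy]⟩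
    exact ⟨a, c, hac, some b, some d, by grind, eab, ecd⟩
  · simp only [localCount] at hc
    obtain ⟨i, hi⟩ := Finset.card_pos.1 (show 0 < (loopSet v h).card by omega)
    obtain ⟨⟨a, b⟩, h1⟩ := Finset.card_pos.1 (show 0 < (multiSet h).card by omega)
    simp only [loopSet, multiSet, Finset.mem_filter, Finset.mem_univ, true_and] at hi h1
    obtain ⟨hab, eab⟩ := h1
    by_cases hia : i = a
    · exact ⟨a, b, hab.ne, none, none, by simp, by grind [extendBy], by grind [extendBy]⟩
    by_cases hib : i = b
    · exact ⟨a, b, hab.ne, none, none, by simp, by grind [extendBy], by grind [extendBy]⟩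
    exact ⟨i, a, hia, none, some b, by grind, hi, eab⟩

theorem localCount_le (v : α) (h : Fin k → α) :
    (localCount v h).1 ≤ k ∧ (localCount v h).2 ≤ k ^ 2 := by
  constructor
  · exact (Finset.card_le_univ (loopSet v h)).trans_eq (by simp)
  · exact (Finset.card_le_univ (multiSet h)).trans_eq (by simp [sq])

variable [Fintype α]

theorem card_mul_sum_localCount_fst (v : α) :
    (Fintype.card α : ℝ) * ∑ h : Fin k → α, ((localCount v h).1 : ℝ) =
      k * Fintype.card (Fin k → α) := by
  have hsum : ∑ h : Fin k → α, ((localCount v h).1 : ℝ) =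
      ∑ i : Fin k, ((Finset.univ.filter fun h : Fin k → α => h i = extendBy v h none).card : ℝ) := by
    simp only [localCount, loopSet, ← Finset.sum_boole]
    exact Finset.sum_comm
  rw [hsum, Finset.mul_sum, Finset.sum_congr rfl fun i _ =>
    card_mul_card_filter_eq_extendBy v (i := i) (s := none) (by simp)]
  simp

theorem card_mul_sum_localCount_snd (v : α) :
    (Fintype.card α : ℝ) * ∑ h : Fin k → α, ((localCount v h).2 : ℝ) =
      k * ((k : ℝ) - 1) / 2 * Fintype.card (Fin k → α) := by
  have hsum : ∑ h : Fin k → α, ((localCount v h).2 : ℝ) =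
      ∑ p ∈ Finset.univ.filter (fun p : Fin k × Fin k => p.1 < p.2),
        ((Finset.univ.filter fun h : Fin k → α => h p.1 = extendBy v h (some p.2)).card : ℝ) := by
    simp only [localCount, multiSet, ← Finset.sum_boole, ← Finset.filter_filter]
    exact Finset.sum_comm
  have hcard : ((Finset.univ.filter fun p : Fin k × Fin k => p.1 < p.2).card : ℝ) =
      k * ((k : ℝ) - 1) / 2 := by
    have h := Finset.sum_range_id_mul_two k
    rw [← Fin.sum_univ_eq_sum_range (fun i => i)] at h
    have h' : ((∑ i : Fin k, (i : ℕ) : ℕ) : ℝ) * 2 = k * ((k : ℝ) - 1) := by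
      rcases k with _ | k
      · simp
      · rw [← Nat.cast_ofNat (n := 2), ← Nat.cast_mul, h]
        push_cast [Nat.add_sub_cancel]
        ring
    rw [← h', mul_div_cancel_right₀ _ two_ne_zero, ← Finset.sum_boole,
      Fintype.sum_prod_type_right, Nat.cast_sum]
    refine Finset.sum_congr rfl fun j _ => ?_
    rw [Finset.sum_boole, Finset.filter_gt_eq_Iio, Fin.card_Iio]
  rw [hsum, Finset.mul_sum, Finset.sum_congr rfl fun p hp => card_mul_card_filter_eq_extendBy v
    (i := p.1) (s := some p.2) (by simpa using (Finset.mem_filter.1 hp).2.ne'), Finset.sum_const,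
    nsmul_eq_mul, hcard]

theorem card_sq_mul_card_two_le_localCount (v : α) :
    (Fintype.card α : ℝ) ^ 2 * (Finset.univ.filter fun h : Fin k → α =>
      2 ≤ (localCount v h).1 + (localCount v h).2).card ≤
      (k * (k + 1)) ^ 2 * Fintype.card (Fin k → α) := by
  let I : Finset ((Fin k × Fin k) × (Option (Fin k) × Option (Fin k))) :=
    Finset.univ.filter fun q => q.1.1 ≠ q.1.2 ∧
      q.2.1 ≠ some q.1.1 ∧ q.2.1 ≠ some q.1.2 ∧ q.2.2 ≠ some q.1.1 ∧ q.2.2 ≠ some q.1.2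
  let B (q : (Fin k × Fin k) × (Option (Fin k) × Option (Fin k))) : Finset (Fin k → α) :=
    Finset.univ.filter fun h => h q.1.1 = extendBy v h q.2.1 ∧ h q.1.2 = extendBy v h q.2.2
  have hsub : (Finset.univ.filter fun h : Fin k → α =>
      2 ≤ (localCount v h).1 + (localCount v h).2) ⊆ I.biUnion B := by
    intro h hh
    obtain ⟨i, j, hij, s, t, hst, e⟩ := exists_two_repeats (Finset.mem_filter.1 hh).2
    refine Finset.mem_biUnion.2 ⟨((i, j), (s, t)), ?_, ?_⟩
    · exact Finset.mem_filter.2 ⟨Finset.mem_univ _, hij, hst⟩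
    · exact Finset.mem_filter.2 ⟨Finset.mem_univ _, e⟩
  have hI : (I.card : ℝ) ≤ (k * (k + 1)) ^ 2 := by
    have := Finset.card_le_univ I
    simp only [Fintype.card_prod, Fintype.card_fin, Fintype.card_option] at this
    calc (I.card : ℝ) ≤ ((k * k * ((k + 1) * (k + 1)) : ℕ) : ℝ) := by exact_mod_cast this
      _ = _ := by push_cast; ring
  calc _ ≤ (Fintype.card α : ℝ) ^ 2 * ∑ q ∈ I, ((B q).card : ℝ) := by
        gcongr
        exact_mod_cast (Finset.card_le_card hsub).trans Finset.card_biUnion_le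
    _ = ∑ q ∈ I, (Fintype.card (Fin k → α) : ℝ) := by
        rw [Finset.mul_sum]
        refine Finset.sum_congr rfl fun q hq => ?_
        obtain ⟨hij, h1, h2, h3, h4⟩ := (Finset.mem_filter.1 hq).2
        exact card_sq_mul_card_filter_eq_extendBy v hij h1 h2 h3 h4
    _ ≤ _ := by
        rw [Finset.sum_const, nsmul_eq_mul]
        gcongr

end LocalCount

section LocalAverage

variable {α : Type*} [DecidableEq α] [Fintype α] {k : ℕ}

/-- Convolution with the law of the numbers of loops and of coinciding pairs out of `v`. -/
noncomputable def localAverage (k : ℕ) (v : α) : BoundedFun →L[ℝ] BoundedFun :=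
  (Fintype.card (Fin k → α) : ℝ)⁻¹ • ∑ h : Fin k → α, shift (localCount v h)

theorem norm_localAverage_le (v : α) : ‖localAverage k v‖ ≤ 1 := by
  have hpos : (0 : ℝ) < Fintype.card (Fin k → α) :=
    Nat.cast_pos.2 (Fintype.card_pos_iff.2 ⟨fun _ => v⟩)
  rw [localAverage, norm_smul, norm_inv, Real.norm_of_nonneg hpos.le, inv_mul_le_one₀ hpos]
  calc _ ≤ ∑ h : Fin k → α, ‖shift (localCount v h)‖ := norm_sum_le _ _
    _ ≤ ∑ h : Fin k → α, (1 : ℝ) := Finset.sum_le_sum fun h _ => norm_shift_le _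
    _ = _ := by simp

theorem shift_eq_one_add_poissonGen {p : ℕ × ℕ} (hp : p.1 + p.2 < 2) :
    shift p - 1 - poissonGen p.1 p.2 = 0 := by
  obtain ⟨l, m⟩ := p
  have h : (l = 0 ∧ m = 0) ∨ (l = 1 ∧ m = 0) ∨ (l = 0 ∧ m = 1) := by simp only at hp; omega
  have h0 : shift (0, 0) = 1 := shift_zero
  rcases h with ⟨rfl, rfl⟩ | ⟨rfl, rfl⟩ | ⟨rfl, rfl⟩ <;> simp [poissonGen, h0]

omit [Fintype α] in
theorem norm_shift_sub_one_sub_poissonGen_le (v : α) (h : Fin k → α) :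
    ‖shift (localCount v h) - 1 - poissonGen (localCount v h).1 (localCount v h).2‖ ≤
      2 + 2 * (k + (k : ℝ) ^ 2) := by
  have h1 : ((localCount v h).1 : ℝ) ≤ k := by exact_mod_cast (localCount_le v h).1
  have h2 : ((localCount v h).2 : ℝ) ≤ (k : ℝ) ^ 2 := by exact_mod_cast (localCount_le v h).2
  calc _ ≤ ‖shift (localCount v h)‖ + ‖(1 : BoundedFun →L[ℝ] BoundedFun)‖ +
        ‖poissonGen (localCount v h).1 (localCount v h).2‖ :=
        (norm_sub_le _ _).trans (by gcongr; exact norm_sub_le _ _)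
    _ ≤ 1 + 1 + 2 * ((localCount v h).1 + (localCount v h).2) := by
        gcongr
        · exact norm_shift_le _
        · exact norm_one.le
        · exact norm_poissonGen_le (Nat.cast_nonneg _) (Nat.cast_nonneg _)
    _ ≤ _ := by linarith

theorem localAverage_sub_one_sub_poissonGen (v : α) :
    localAverage k v - 1 -
        poissonGen (k / Fintype.card α) (k * ((k : ℝ) - 1) / 2 / Fintype.card α) =
      (Fintype.card (Fin k → α) : ℝ)⁻¹ • ∑ h : Fin k → α,
        (shift (localCount v h) - 1 - poissonGen (localCount v h).1 (localCount v h).2) := by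
  have hn : (Fintype.card α : ℝ) ≠ 0 :=
    Nat.cast_ne_zero.2 (Fintype.card_pos_iff.2 ⟨v⟩).ne'
  have hN : (Fintype.card (Fin k → α) : ℝ) ≠ 0 :=
    Nat.cast_ne_zero.2 (Fintype.card_pos_iff.2 ⟨fun _ => v⟩).ne'
  have h1 := card_mul_sum_localCount_fst (k := k) v
  have h2 := card_mul_sum_localCount_snd (k := k) v
  have e1 : (k : ℝ) / Fintype.card α = (Fintype.card (Fin k → α) : ℝ)⁻¹ *
      ∑ h : Fin k → α, ((localCount v h).1 : ℝ) := by
    rw [div_eq_iff hn, mul_assoc, mul_comm (∑ h, _), h1, mul_comm (k : ℝ), inv_mul_cancel_left₀ hN]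
  have e2 : k * ((k : ℝ) - 1) / 2 / Fintype.card α = (Fintype.card (Fin k → α) : ℝ)⁻¹ *
      ∑ h : Fin k → α, ((localCount v h).2 : ℝ) := by
    rw [div_eq_iff hn, mul_assoc, mul_comm (∑ h, _), h2, mul_comm (k * _ / _ : ℝ),
      inv_mul_cancel_left₀ hN]
  have e3 : (1 : BoundedFun →L[ℝ] BoundedFun) =
      (Fintype.card (Fin k → α) : ℝ)⁻¹ • ∑ _h : Fin k → α, 1 := by
    rw [Finset.sum_const, Finset.card_univ, ← Nat.cast_smul_eq_nsmul ℝ, inv_smul_smul₀ hN]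
  rw [e1, e2, localAverage]
  conv_lhs => rw [e3]
  simp only [poissonGen, Finset.sum_sub_distrib, Finset.sum_add_distrib, ← Finset.sum_smul,
    smul_sub, smul_add, mul_smul]

theorem norm_localAverage_sub_le (v : α) :
    ‖localAverage k v - 1 -
        poissonGen (k / Fintype.card α) (k * ((k : ℝ) - 1) / 2 / Fintype.card α)‖ ≤
      (2 + 2 * (k + (k : ℝ) ^ 2)) * (k * (k + 1)) ^ 2 / (Fintype.card α : ℝ) ^ 2 := by
  have hn : (0 : ℝ) < Fintype.card α := Nat.cast_pos.2 (Fintype.card_pos_iff.2 ⟨v⟩)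
  have hN : (0 : ℝ) < Fintype.card (Fin k → α) :=
    Nat.cast_pos.2 (Fintype.card_pos_iff.2 ⟨fun _ => v⟩)
  rw [localAverage_sub_one_sub_poissonGen, norm_smul, norm_inv, Real.norm_of_nonneg hN.le,
    inv_mul_le_iff₀ hN, ← mul_div_assoc, le_div_iff₀ (by positivity)]
  set bad := Finset.univ.filter fun h : Fin k → α =>
    2 ≤ (localCount v h).1 + (localCount v h).2
  have hsum : ‖∑ h : Fin k → α, (shift (localCount v h) - 1 -
      poissonGen (localCount v h).1 (localCount v h).2)‖ ≤
      bad.card * (2 + 2 * (k + (k : ℝ) ^ 2)) := by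
    rw [← Finset.sum_subset (Finset.subset_univ bad) fun h _ hh => shift_eq_one_add_poissonGen
      (by simpa [bad] using hh), ← nsmul_eq_mul]
    exact (norm_sum_le_of_le _ fun h _ => norm_shift_sub_one_sub_poissonGen_le v h).trans_eq
      (Finset.sum_const _)
  calc _ ≤ bad.card * (2 + 2 * (k + (k : ℝ) ^ 2)) * (Fintype.card α : ℝ) ^ 2 := by gcongr
    _ = (2 + 2 * (k + (k : ℝ) ^ 2)) * ((Fintype.card α : ℝ) ^ 2 * bad.card) := by ring
    _ ≤ (2 + 2 * (k + (k : ℝ) ^ 2)) *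
        ((k * (k + 1)) ^ 2 * Fintype.card (Fin k → α)) := by
        exact mul_le_mul_of_nonneg_left (card_sq_mul_card_two_le_localCount v) (by positivity)
    _ = _ := by ring

end LocalAverage

section Digraph

variable {n k : ℕ}

theorem sum_localCount_curry (f : Fin n × Fin k → Fin n) :
    ∑ v, localCount v (Function.curry f v) = (numLoops f, numMulti f) := by
  refine Prod.ext ?_ ?_
  · rw [numLoops, Finset.card_filter, Fintype.sum_prod_type, Prod.fst_sum]
    refine Finset.sum_congr rfl fun v _ => ?_
    rw [localCount, loopSet, Finset.card_filter]
    rfl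
  · rw [numMulti, Finset.card_filter, Fintype.sum_prod_type, Prod.snd_sum]
    exact Finset.sum_congr rfl fun v _ => Finset.card_filter _ _

theorem prod_localAverage :
    ((List.finRange n).map (localAverage k)).prod =
      (Fintype.card (Fin n × Fin k → Fin n) : ℝ)⁻¹ •
        ∑ f : Fin n × Fin k → Fin n, shift (numLoops f, numMulti f) := by
  let Φ := AddMonoidAlgebra.lift ℝ (BoundedFun →L[ℝ] BoundedFun) (ℕ × ℕ) shiftHom
  have hΦ (p : ℕ × ℕ) : Φ (AddMonoidAlgebra.single p 1) = shift p := by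
    simp [Φ, AddMonoidAlgebra.lift_single, shiftHom]
  have hexpand : ∏ v : Fin n, ∑ h : Fin k → Fin n,
      AddMonoidAlgebra.single (localCount v h) (1 : ℝ) =
      ∑ f : Fin n × Fin k → Fin n, AddMonoidAlgebra.single (numLoops f, numMulti f) (1 : ℝ) := by
    rw [Finset.prod_univ_sum, Fintype.piFinset_univ,
      ← Equiv.sum_comp (Equiv.curry (Fin n) (Fin k) (Fin n))]
    refine Finset.sum_congr rfl fun f _ => ?_
    rw [AddMonoidAlgebra.prod_single, Finset.prod_const_one, ← sum_localCount_curry]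
    rfl
  have hcard : (Fintype.card (Fin n × Fin k → Fin n) : ℝ)⁻¹ =
      (Fintype.card (Fin k → Fin n) : ℝ)⁻¹ ^ (List.finRange n).length := by
    simp [pow_mul, mul_comm n k]
  have hΦprod := congrArg Φ hexpand
  rw [Fin.prod_univ_def, map_list_prod, List.map_map] at hΦprod
  simp only [Function.comp_def, map_sum, hΦ] at hΦprod
  rw [hcard, ← hΦprod, ← List.length_map, List.smul_prod, List.map_map]
  rfl

theorem prob_eq_prod_localAverage_apply (A : Set (ℕ × ℕ)) :
    prob n k (fun f => (numLoops f, numMulti f) ∈ A) =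
      ((List.finRange n).map (localAverage k)).prod (BoundedFun.indicator A) 0 := by
  have h := congrArg (fun T => BoundedFun.evalAt 0 (T (BoundedFun.indicator A)))
    (prod_localAverage (n := n) (k := k))
  refine Eq.trans ?_ h.symm
  simp only [smul_apply, sum_apply, map_smul, map_sum, smul_eq_mul]
  simp only [BoundedFun.evalAt_apply, shift_apply, zero_add, BoundedFun.indicator_apply,
    Finset.sum_boole, prob, div_eq_inv_mul]

end Digraph

/-- The pair (number of self-loops, number of coinciding arc pairs) of `𝒟_{n,k}` is
within total variation distance `O(1/n)` of a pair of independent Poisson random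
variables with means `k` and `k(k-1)/2`. -/
theorem loops_multiarcs_poisson_tv (k : ℕ) (hk : 2 ≤ k) :
    ∃ C : ℝ, ∀ n : ℕ, 1 ≤ n → ∀ A : Set (ℕ × ℕ),
      |prob n k (fun f => (numLoops f, numMulti f) ∈ A) -
        poissonPairProb (k : ℝ) ((k : ℝ) * ((k : ℝ) - 1) / 2) A| ≤ C / n := by
  set a : ℝ := (k : ℝ)
  set b : ℝ := a * (a - 1) / 2
  have ha0 : 0 ≤ a := Nat.cast_nonneg k
  have hb0 : 0 ≤ b := by
    have : 0 ≤ a - 1 := sub_nonneg.2 (Nat.one_le_cast.2 (one_le_two.trans hk))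
    positivity
  set C₁ : ℝ := (2 + 2 * (a + a ^ 2)) * (a * (a + 1)) ^ 2
  set c : ℝ := 2 * (a + b)
  refine ⟨C₁ + c ^ 2 * Real.exp c, fun n hn A => ?_⟩
  have hn0 : (0 : ℝ) < n := by exact_mod_cast hn
  have hn1 : (1 : ℝ) ≤ n := by exact_mod_cast hn
  let U := NormedSpace.exp (poissonGen (a / n) (b / n))
  have hUpow : U ^ n = NormedSpace.exp (poissonGen a b) := by
    let _ := NormedAlgebra.restrictScalars ℚ ℝ (BoundedFun →L[ℝ] BoundedFun)
    rw [← NormedSpace.exp_nsmul]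
    congr 1
    rw [poissonGen, poissonGen, ← Nat.cast_smul_eq_nsmul ℝ, smul_add, smul_smul, smul_smul,
      mul_div_cancel₀ _ hn0.ne', mul_div_cancel₀ _ hn0.ne']
  have hUgen : ‖U - 1 - poissonGen (a / n) (b / n)‖ ≤ c ^ 2 * Real.exp c / (n : ℝ) ^ 2 := by
    have hgen : ‖poissonGen (a / n) (b / n)‖ ≤ c / n :=
      (norm_poissonGen_le (by positivity) (by positivity)).trans_eq (by ring)
    have hc : c / n ≤ c := div_le_self (by positivity) hn1
    calc _ ≤ ‖poissonGen (a / n) (b / n)‖ ^ 2 * Real.exp ‖poissonGen (a / n) (b / n)‖ :=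
          norm_exp_sub_one_sub_self_le _
      _ ≤ (c / n) ^ 2 * Real.exp c := by
          gcongr
          exact hgen.trans hc
      _ = _ := by ring
  have hTU (v : Fin n) : ‖localAverage k v - U‖ ≤ (C₁ + c ^ 2 * Real.exp c) / (n : ℝ) ^ 2 := by
    have hT := norm_localAverage_sub_le (k := k) v
    rw [Fintype.card_fin] at hT
    rw [add_div, ← sub_sub_sub_cancel_right _ U 1,
      ← sub_sub_sub_cancel_right _ (U - 1) (poissonGen (a / n) (b / n))]
    exact (norm_sub_le _ _).trans (add_le_add hT hUgen)
  have hprod := norm_prod_map_sub_pow_le (localAverage k) U _ norm_localAverage_le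
    (norm_exp_poissonGen_le_one (by positivity) (by positivity)) hTU (List.finRange n)
  rw [List.length_finRange, hUpow] at hprod
  rw [prob_eq_prod_localAverage_apply, poissonPairProb_eq_exp_apply]
  calc _ = |(((List.finRange n).map (localAverage k)).prod - NormedSpace.exp (poissonGen a b))
        (BoundedFun.indicator A) 0| := rfl
    _ ≤ _ := BoundedFun.abs_apply_indicator_le _ A 0
    _ ≤ _ := hprod
    _ = _ := by field_simp
end
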